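/- arXiv:2111.00370 — 2 statements merged into one kernel-verified Lean document; each statement's English description precedes it below -/
import Mathlib

section
/- Let (H, p) and (H', p') be quasitriangular Hopf algebras and r = r_k ⊗ r^k ∈ H ⊗ H' a weak R-matrix of (H, H') with R = r⁻¹ = R_n ⊗ R^n. Set [p, p'] = (r_k pᵢ ⊗ p'ⱼ R^n) ⊗ (pⁱ R_n ⊗ r^k p'ʲ) ∈ (H ⊗ H') ⊗ (H ⊗ H'). Then (H ⊗ H', [p, p'], id_{H⊗H'}, S_H⁻² ⊗ S_{H'}⁻²) is an oriented quantum algebra. -/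
open TensorProduct

noncomputable section

namespace OQApaper

variable (K : Type*) [Field K]

section Maps

variable (A B C D : Type*) [Ring A] [Ring B] [Ring C] [Ring D]
  [Algebra K A] [Algebra K B] [Algebra K C] [Algebra K D]

/-- The linear embedding `A ⊗ B → A ⊗ Bᵐᵒᵖ` (identity on the first factor, `op` on the
second), used to phrase statements about products in `H ⊗ H'^op`. -/
def opify : A ⊗[K] B →ₗ[K] A ⊗[K] Bᵐᵒᵖ :=
  TensorProduct.map LinearMap.id (MulOpposite.opLinearEquiv K).toLinearMap

/-- `a ⊗ b ↦ a ⊗ b ⊗ 1` into `A ⊗ (B ⊗ C)`. -/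
def emb12 : A ⊗[K] B →ₐ[K] A ⊗[K] (B ⊗[K] C) :=
  Algebra.TensorProduct.map (AlgHom.id K A) Algebra.TensorProduct.includeLeft

/-- `a ⊗ c ↦ a ⊗ 1 ⊗ c` into `A ⊗ (B ⊗ C)`. -/
def emb13 : A ⊗[K] C →ₐ[K] A ⊗[K] (B ⊗[K] C) :=
  Algebra.TensorProduct.map (AlgHom.id K A) Algebra.TensorProduct.includeRight

/-- `b ⊗ c ↦ 1 ⊗ b ⊗ c` into `A ⊗ (B ⊗ C)`. -/
def emb23 : B ⊗[K] C →ₐ[K] A ⊗[K] (B ⊗[K] C) :=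
  Algebra.TensorProduct.includeRight

/-- `b ⊗ a ↦ a ⊗ b ⊗ 1` into `A ⊗ (B ⊗ C)` (swapped version of `emb12`). -/
def emb21 : B ⊗[K] A →ₐ[K] A ⊗[K] (B ⊗[K] C) :=
  (emb12 K A B C).comp (Algebra.TensorProduct.comm K B A).toAlgHom

/-- `c ⊗ b ↦ 1 ⊗ b ⊗ c` into `A ⊗ (B ⊗ C)` (swapped version of `emb23`). -/
def emb32 : C ⊗[K] B →ₐ[K] A ⊗[K] (B ⊗[K] C) :=
  (emb23 K A B C).comp (Algebra.TensorProduct.comm K C B).toAlgHom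

/-- `a ⊗ c ↦ (a ⊗ 1) ⊗ (c ⊗ 1)` into `(A ⊗ B) ⊗ (C ⊗ D)`. -/
def E13 : A ⊗[K] C →ₐ[K] (A ⊗[K] B) ⊗[K] (C ⊗[K] D) :=
  Algebra.TensorProduct.map Algebra.TensorProduct.includeLeft
    Algebra.TensorProduct.includeLeft

/-- `a ⊗ d ↦ (a ⊗ 1) ⊗ (1 ⊗ d)` into `(A ⊗ B) ⊗ (C ⊗ D)`. -/
def E14 : A ⊗[K] D →ₐ[K] (A ⊗[K] B) ⊗[K] (C ⊗[K] D) :=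
  Algebra.TensorProduct.map Algebra.TensorProduct.includeLeft
    Algebra.TensorProduct.includeRight

/-- `b ⊗ d ↦ (1 ⊗ b) ⊗ (1 ⊗ d)` into `(A ⊗ B) ⊗ (C ⊗ D)`. -/
def E24 : B ⊗[K] D →ₐ[K] (A ⊗[K] B) ⊗[K] (C ⊗[K] D) :=
  Algebra.TensorProduct.map Algebra.TensorProduct.includeRight
    Algebra.TensorProduct.includeRight

/-- `b ⊗ c ↦ (1 ⊗ b) ⊗ (c ⊗ 1)` into `(A ⊗ B) ⊗ (C ⊗ D)`. -/
def E23 : B ⊗[K] C →ₐ[K] (A ⊗[K] B) ⊗[K] (C ⊗[K] D) :=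
  Algebra.TensorProduct.map Algebra.TensorProduct.includeRight
    Algebra.TensorProduct.includeLeft

/-- `c ⊗ b ↦ (1 ⊗ b) ⊗ (c ⊗ 1)` into `(A ⊗ B) ⊗ (C ⊗ D)` (swapped `E23`). -/
def E32 : C ⊗[K] B →ₐ[K] (A ⊗[K] B) ⊗[K] (C ⊗[K] D) :=
  (E23 K A B C D).comp (Algebra.TensorProduct.comm K C B).toAlgHom

end Maps

section Defs

variable {A B : Type*} [Ring A] [Ring B] [Algebra K A] [Algebra K B]

/-- An oriented quantum algebra `(A, r, σ, τ)` (Definition 1.1), with the inverse `ri`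
of `r` given explicitly:  `σ, τ` are commuting algebra automorphisms, `(σ ⊗ id)(r⁻¹)`
and `(id ⊗ τ)(r)` are inverses in `A ⊗ Aᵐᵒᵖ`, `(σ ⊗ σ)(r) = r = (τ ⊗ τ)(r)`, and `r`
satisfies the quantum Yang–Baxter equation. -/
structure IsOQA (r ri : A ⊗[K] A) (σ τ : A ≃ₐ[K] A) : Prop where
  comm_auto : ∀ a : A, σ (τ a) = τ (σ a)
  mul_inv : r * ri = 1
  inv_mul : ri * r = 1
  op_mul_inv :
    opify K A A (Algebra.TensorProduct.map σ.toAlgHom (AlgHom.id K A) ri) *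
      opify K A A (Algebra.TensorProduct.map (AlgHom.id K A) τ.toAlgHom r) = 1
  op_inv_mul :
    opify K A A (Algebra.TensorProduct.map (AlgHom.id K A) τ.toAlgHom r) *
      opify K A A (Algebra.TensorProduct.map σ.toAlgHom (AlgHom.id K A) ri) = 1
  map_sigma : Algebra.TensorProduct.map σ.toAlgHom σ.toAlgHom r = r
  map_tau : Algebra.TensorProduct.map τ.toAlgHom τ.toAlgHom r = r
  qybe : emb12 K A A A r * emb13 K A A A r * emb23 K A A A r =
    emb23 K A A A r * emb13 K A A A r * emb12 K A A A r

/-- An OQA nonuple `(A, B, p, p', r, σ, τ, σ', τ')` (Definition 3.1), with explicit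
inverses `pinv, p'inv, rinv`. -/
structure IsOQANonuple (p pinv : A ⊗[K] A) (p' p'inv : B ⊗[K] B) (r rinv : A ⊗[K] B)
    (σ τ : A ≃ₐ[K] A) (σ' τ' : B ≃ₐ[K] B) : Prop where
  comm_auto : ∀ a : A, σ (τ a) = τ (σ a)
  comm_auto' : ∀ b : B, σ' (τ' b) = τ' (σ' b)
  p_mul_inv : p * pinv = 1
  p_inv_mul : pinv * p = 1
  p'_mul_inv : p' * p'inv = 1
  p'_inv_mul : p'inv * p' = 1
  r_mul_inv : r * rinv = 1
  r_inv_mul : rinv * r = 1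
  op_mul_inv :
    opify K A B (Algebra.TensorProduct.map σ.toAlgHom (AlgHom.id K B) rinv) *
      opify K A B (Algebra.TensorProduct.map (AlgHom.id K A) τ'.toAlgHom r) = 1
  op_inv_mul :
    opify K A B (Algebra.TensorProduct.map (AlgHom.id K A) τ'.toAlgHom r) *
      opify K A B (Algebra.TensorProduct.map σ.toAlgHom (AlgHom.id K B) rinv) = 1
  map_sigma : Algebra.TensorProduct.map σ.toAlgHom σ'.toAlgHom r = r
  map_tau : Algebra.TensorProduct.map τ.toAlgHom τ'.toAlgHom r = r
  cond3 : emb12 K A A B p * emb13 K A A B r * emb23 K A A B r =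
    emb23 K A A B r * emb13 K A A B r * emb12 K A A B p
  cond4 : emb12 K A B B r * emb13 K A B B r * emb23 K A B B p' =
    emb23 K A B B p' * emb13 K A B B r * emb12 K A B B r

end Defs

section BialgDefs

variable {A B : Type*} [Ring A] [Ring B] [Bialgebra K A] [Bialgebra K B]

/-- A weak R-matrix of `(A, B)` (Definition 2.6):  an invertible `r ∈ A ⊗ B` with
`(Δ ⊗ id)(r) = r₁₃ r₂₃` and `(id ⊗ Δ)(r) = r₁₃ r₁₂`. -/
structure IsWeakR (r : A ⊗[K] B) : Prop where
  isUnit : IsUnit r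
  comul_left :
    TensorProduct.assoc K A A B
        (TensorProduct.map (Coalgebra.comul (R := K)) LinearMap.id r) =
      emb13 K A A B r * emb23 K A A B r
  comul_right :
    TensorProduct.map LinearMap.id (Coalgebra.comul (R := K)) r =
      emb13 K A B B r * emb12 K A B B r

/-- A quasitriangular structure `p` on a bialgebra `A` (Definition 2.4). -/
structure IsQT (p : A ⊗[K] A) : Prop where
  comul_left :
    TensorProduct.assoc K A A A
        (TensorProduct.map (Coalgebra.comul (R := K)) LinearMap.id p) =
      emb13 K A A A p * emb23 K A A A p
  comul_right :
    TensorProduct.map LinearMap.id (Coalgebra.comul (R := K)) p =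
      emb13 K A A A p * emb12 K A A A p
  almost_cocomm : ∀ h : A,
    TensorProduct.comm K A A (Coalgebra.comul (R := K) h) * p =
      p * Coalgebra.comul (R := K) h
  counit_left :
    TensorProduct.lid K A
      (TensorProduct.map (Coalgebra.counit (R := K)) LinearMap.id p) = 1
  counit_right :
    TensorProduct.rid K A
      (TensorProduct.map LinearMap.id (Coalgebra.counit (R := K)) p) = 1

end BialgDefs

end OQApaper

open OQApaper

namespace OQApaper

open Coalgebra HopfAlgebra

section WeakR

variable {K : Type*} [Field K] {A B : Type*} [Ring A] [Ring B]

section Bialgebra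

variable [Bialgebra K A] [Bialgebra K B] {r : A ⊗[K] B}

theorem map_linearMap_comp_counit_left
    (h : TensorProduct.lid K B (TensorProduct.map (counit (R := K)) LinearMap.id r) = 1) :
    TensorProduct.map (Algebra.linearMap K A ∘ₗ counit) LinearMap.id r = 1 := by
  have key : ∀ x : A ⊗[K] B,
      TensorProduct.map (Algebra.linearMap K A ∘ₗ counit) LinearMap.id x =
        (1 : A) ⊗ₜ[K] TensorProduct.lid K B
          (TensorProduct.map (counit (R := K)) LinearMap.id x) := fun x => by
    induction x using TensorProduct.induction_on with
    | zero => simp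
    | tmul a b => simp [Algebra.algebraMap_eq_smul_one, TensorProduct.smul_tmul]
    | add x y hx hy => simp only [map_add, hx, hy, TensorProduct.tmul_add]
  rw [key, h, Algebra.TensorProduct.one_def]

/-- The algebra map `ε ⊗ id ⊗ id`. -/
def counitFst (K A B : Type*) [Field K] [Ring A] [Ring B] [Bialgebra K A] [Algebra K B] :
    A ⊗[K] (A ⊗[K] B) →ₐ[K] A ⊗[K] B :=
  (Algebra.TensorProduct.lid K (A ⊗[K] B)).toAlgHom.comp
    (Algebra.TensorProduct.map (Bialgebra.counitAlgHom K A) (AlgHom.id K _))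

/-- The algebra map `id ⊗ ε ⊗ id`. -/
def counitMid (K A B : Type*) [Field K] [Ring A] [Ring B] [Algebra K A] [Bialgebra K B] :
    A ⊗[K] (B ⊗[K] B) →ₐ[K] A ⊗[K] B :=
  Algebra.TensorProduct.map (AlgHom.id K A)
    ((Algebra.TensorProduct.lid K B).toAlgHom.comp
      (Algebra.TensorProduct.map (Bialgebra.counitAlgHom K B) (AlgHom.id K B)))

theorem counitFst_comul (x : A ⊗[K] B) :
    counitFst K A B (TensorProduct.assoc K A A B
      (TensorProduct.map (comul (R := K)) LinearMap.id x)) = x := by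
  induction x using TensorProduct.induction_on with
  | zero => simp
  | tmul a b =>
    have key : ∀ y : A ⊗[K] A, counitFst K A B (TensorProduct.assoc K A A B (y ⊗ₜ b)) =
        TensorProduct.lid K A (counit.rTensor A y) ⊗ₜ b := fun y => by
      induction y using TensorProduct.induction_on with
      | zero => simp
      | tmul c d => simp [counitFst, TensorProduct.smul_tmul']
      | add x y hx hy => simp only [map_add, hx, hy, TensorProduct.add_tmul]
    simp [key]
  | add x y hx hy => simp only [map_add, hx, hy]

theorem counitMid_comul (x : A ⊗[K] B) :
    counitMid K A B (TensorProduct.map LinearMap.id (comul (R := K)) x) = x := by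
  induction x using TensorProduct.induction_on with
  | zero => simp
  | tmul a b =>
    have key : ∀ y : B ⊗[K] B, counitMid K A B (a ⊗ₜ y) =
        a ⊗ₜ TensorProduct.lid K B (counit.rTensor B y) := fun y => by
      induction y using TensorProduct.induction_on with
      | zero => simp
      | tmul c d => simp [counitMid]
      | add x y hx hy => simp only [map_add, hx, hy, TensorProduct.tmul_add]
    simp [key]
  | add x y hx hy => simp only [map_add, hx, hy]

theorem counitFst_emb13 (x : A ⊗[K] B) :
    counitFst K A B (emb13 K A A B x) =
      TensorProduct.map (Algebra.linearMap K A ∘ₗ counit) LinearMap.id x := by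
  induction x using TensorProduct.induction_on with
  | zero => simp
  | tmul a b =>
    simp [counitFst, emb13, Algebra.algebraMap_eq_smul_one, TensorProduct.smul_tmul']
  | add x y hx hy => simp only [map_add, hx, hy]

theorem counitFst_emb23 (x : A ⊗[K] B) : counitFst K A B (emb23 K A A B x) = x := by
  simp [counitFst, emb23]

theorem counitMid_emb13 (x : A ⊗[K] B) : counitMid K A B (emb13 K A B B x) = x := by
  induction x using TensorProduct.induction_on with
  | zero => simp
  | tmul a b => simp [counitMid, emb13]
  | add x y hx hy => simp only [map_add, hx, hy]

theorem counitMid_emb12 (x : A ⊗[K] B) :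
    counitMid K A B (emb12 K A B B x) =
      TensorProduct.map LinearMap.id (Algebra.linearMap K B ∘ₗ counit) x := by
  induction x using TensorProduct.induction_on with
  | zero => simp
  | tmul a b =>
    simp [counitMid, emb12, Algebra.algebraMap_eq_smul_one]
  | add x y hx hy => simp only [map_add, hx, hy]

theorem IsWeakR.map_counit_left (hw : IsWeakR K r) :
    TensorProduct.map (Algebra.linearMap K A ∘ₗ counit) LinearMap.id r = 1 := by
  have h := congrArg (counitFst K A B) hw.comul_left
  rw [counitFst_comul, map_mul, counitFst_emb13, counitFst_emb23] at h
  exact hw.isUnit.mul_right_cancel (by rw [← h, one_mul])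

theorem IsWeakR.map_counit_right (hw : IsWeakR K r) :
    TensorProduct.map LinearMap.id (Algebra.linearMap K B ∘ₗ counit) r = 1 := by
  have h := congrArg (counitMid K A B) hw.comul_right
  rw [counitMid_comul, map_mul, counitMid_emb13, counitMid_emb12] at h
  exact hw.isUnit.mul_left_cancel (by rw [← h, mul_one])

end Bialgebra

section AntipodeLeft

variable [HopfAlgebra K A] [Bialgebra K B] {r : A ⊗[K] B}

theorem map_antipode_left_mul
    (hc : TensorProduct.assoc K A A B (TensorProduct.map (comul (R := K)) LinearMap.id r) =
      emb13 K A A B r * emb23 K A A B r)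
    (he : TensorProduct.map (Algebra.linearMap K A ∘ₗ counit) LinearMap.id r = 1) :
    TensorProduct.map (antipode K) LinearMap.id r * r = 1 := by
  let Φ : A ⊗[K] (A ⊗[K] B) →ₗ[K] A ⊗[K] B :=
    TensorProduct.map (LinearMap.mul' K A ∘ₗ (antipode K).rTensor A) LinearMap.id ∘ₗ
      (TensorProduct.assoc K A A B).symm.toLinearMap
  have hΦ : ∀ x y : A ⊗[K] B, Φ (emb13 K A A B x * emb23 K A A B y) =
      TensorProduct.map (antipode K) LinearMap.id x * y := fun x y => by
    induction x using TensorProduct.induction_on with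
    | zero => simp
    | tmul a b =>
      induction y using TensorProduct.induction_on with
      | zero => simp
      | tmul c d => simp [Φ, emb13, emb23]
      | add x y hx hy => simp only [map_add, mul_add, hx, hy]
    | add x y hx hy => simp only [map_add, add_mul, hx, hy]
  rw [← hΦ, ← hc, ← he]
  simp only [Φ, LinearMap.comp_apply, LinearEquiv.coe_coe, LinearEquiv.symm_apply_apply,
    ← mul_antipode_rTensor_comul]
  simp only [TensorProduct.map_map, LinearMap.id_comp, LinearMap.comp_assoc]

theorem mul_map_antipode_left
    (hc : TensorProduct.assoc K A A B (TensorProduct.map (comul (R := K)) LinearMap.id r) =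
      emb13 K A A B r * emb23 K A A B r)
    (he : TensorProduct.map (Algebra.linearMap K A ∘ₗ counit) LinearMap.id r = 1) :
    r * TensorProduct.map (antipode K) LinearMap.id r = 1 := by
  let Φ : A ⊗[K] (A ⊗[K] B) →ₗ[K] A ⊗[K] B :=
    TensorProduct.map (LinearMap.mul' K A ∘ₗ (antipode K).lTensor A) LinearMap.id ∘ₗ
      (TensorProduct.assoc K A A B).symm.toLinearMap
  have hΦ : ∀ x y : A ⊗[K] B, Φ (emb13 K A A B x * emb23 K A A B y) =
      x * TensorProduct.map (antipode K) LinearMap.id y := fun x y => by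
    induction x using TensorProduct.induction_on with
    | zero => simp
    | tmul a b =>
      induction y using TensorProduct.induction_on with
      | zero => simp
      | tmul c d => simp [Φ, emb13, emb23]
      | add x y hx hy => simp only [map_add, mul_add, hx, hy]
    | add x y hx hy => simp only [map_add, add_mul, hx, hy]
  rw [← hΦ, ← hc, ← he]
  simp only [Φ, LinearMap.comp_apply, LinearEquiv.coe_coe, LinearEquiv.symm_apply_apply,
    ← mul_antipode_lTensor_comul]
  simp only [TensorProduct.map_map, LinearMap.id_comp, LinearMap.comp_assoc]

theorem IsWeakR.map_antipode_left (hw : IsWeakR K r) {rinv : A ⊗[K] B} (h : r * rinv = 1) :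
    TensorProduct.map (antipode K) LinearMap.id r = rinv :=
  left_inv_eq_right_inv (map_antipode_left_mul hw.comul_left hw.map_counit_left) h

end AntipodeLeft

section AntipodeRight

variable [Bialgebra K A] [HopfAlgebra K B] {r : A ⊗[K] B}

theorem IsWeakR.opify_mul_opify_antipode (hw : IsWeakR K r) :
    opify K A B r * opify K A B (TensorProduct.map LinearMap.id (antipode K) r) = 1 := by
  let Φ : A ⊗[K] (B ⊗[K] B) →ₗ[K] A ⊗[K] Bᵐᵒᵖ :=
    opify K A B ∘ₗ
      TensorProduct.map LinearMap.id (LinearMap.mul' K B ∘ₗ (antipode K).rTensor B)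
  have hΦ : ∀ x y : A ⊗[K] B, Φ (emb13 K A B B x * emb12 K A B B y) =
      opify K A B x *
        opify K A B (TensorProduct.map LinearMap.id (antipode K) y) := fun x y => by
    induction x using TensorProduct.induction_on with
    | zero => simp
    | tmul a b =>
      induction y using TensorProduct.induction_on with
      | zero => simp
      | tmul c d => simp [Φ, emb13, emb12, opify]
      | add x y hx hy => simp only [map_add, mul_add, hx, hy]
    | add x y hx hy => simp only [map_add, add_mul, hx, hy]
  have h1 : opify K A B 1 = 1 := by simp [opify, Algebra.TensorProduct.one_def]
  rw [← hΦ, ← hw.comul_right, ← h1, ← hw.map_counit_right]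
  simp only [Φ, LinearMap.comp_apply, ← mul_antipode_rTensor_comul]
  simp only [TensorProduct.map_map, LinearMap.id_comp, LinearMap.comp_assoc]

theorem IsWeakR.opify_antipode_mul_opify (hw : IsWeakR K r) :
    opify K A B (TensorProduct.map LinearMap.id (antipode K) r) * opify K A B r = 1 := by
  let Φ : A ⊗[K] (B ⊗[K] B) →ₗ[K] A ⊗[K] Bᵐᵒᵖ :=
    opify K A B ∘ₗ
      TensorProduct.map LinearMap.id (LinearMap.mul' K B ∘ₗ (antipode K).lTensor B)
  have hΦ : ∀ x y : A ⊗[K] B, Φ (emb13 K A B B x * emb12 K A B B y) =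
      opify K A B (TensorProduct.map LinearMap.id (antipode K) x) *
        opify K A B y := fun x y => by
    induction x using TensorProduct.induction_on with
    | zero => simp
    | tmul a b =>
      induction y using TensorProduct.induction_on with
      | zero => simp
      | tmul c d => simp [Φ, emb13, emb12, opify]
      | add x y hx hy => simp only [map_add, mul_add, hx, hy]
    | add x y hx hy => simp only [map_add, add_mul, hx, hy]
  have h1 : opify K A B 1 = 1 := by simp [opify, Algebra.TensorProduct.one_def]
  rw [← hΦ, ← hw.comul_right, ← h1, ← hw.map_counit_right]
  simp only [Φ, LinearMap.comp_apply, ← mul_antipode_lTensor_comul]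
  simp only [TensorProduct.map_map, LinearMap.id_comp, LinearMap.comp_assoc]

end AntipodeRight

section Antipodes

variable [HopfAlgebra K A] [HopfAlgebra K B] {r rinv : A ⊗[K] B}

theorem IsWeakR.map_antipode_right (hw : IsWeakR K r) (h1 : r * rinv = 1) :
    TensorProduct.map LinearMap.id (antipode K) rinv = r := by
  let Ψ : A ⊗[K] Bᵐᵒᵖ →ₗ[K] A ⊗[K] B :=
    TensorProduct.map (antipode K) (MulOpposite.opLinearEquiv K).symm.toLinearMap
  have hΨ : ∀ x y : A ⊗[K] B, Ψ (opify K A B x * opify K A B y) =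
      TensorProduct.map (antipode K) LinearMap.id y *
        TensorProduct.map (antipode K) LinearMap.id x := fun x y => by
    induction x using TensorProduct.induction_on with
    | zero => simp
    | tmul a b =>
      induction y using TensorProduct.induction_on with
      | zero => simp
      | tmul c d => simp [Ψ, opify, antipode_mul_antidistrib]
      | add x y hx hy => simp only [map_add, mul_add, add_mul, hx, hy]
    | add x y hx hy => simp only [map_add, add_mul, mul_add, hx, hy]
  have hcomm : TensorProduct.map (antipode K) LinearMap.id
      (TensorProduct.map LinearMap.id (antipode K) r) =
      TensorProduct.map LinearMap.id (antipode K) rinv := by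
    rw [← hw.map_antipode_left h1]
    simp only [TensorProduct.map_map, LinearMap.id_comp, LinearMap.comp_id]
  have h := congrArg Ψ hw.opify_antipode_mul_opify
  rw [hΨ, hcomm, hw.map_antipode_left h1] at h
  have hone : Ψ 1 = 1 := by simp [Ψ, Algebra.TensorProduct.one_def]
  rw [hone] at h
  exact (left_inv_eq_right_inv h1 h).symm

theorem IsWeakR.map_antipode_antipode (hw : IsWeakR K r) :
    TensorProduct.map (antipode K) (antipode K) r = r := by
  obtain ⟨s, h1, -⟩ := isUnit_iff_exists.mp hw.isUnit
  conv_rhs => rw [← hw.map_antipode_right h1, ← hw.map_antipode_left h1]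
  simp only [TensorProduct.map_map, LinearMap.id_comp, LinearMap.comp_id]

end Antipodes

end WeakR

section Quasitriangular

variable {K : Type*} [Field K]

section Bialgebra

variable {A B : Type*} [Ring A] [Ring B]

/-- Interchange of the first two tensor factors. -/
def swap12 (K A B : Type*) [Field K] [Ring A] [Ring B] [Algebra K A] [Algebra K B] :
    A ⊗[K] (A ⊗[K] B) →ₐ[K] A ⊗[K] (A ⊗[K] B) :=
  (Algebra.TensorProduct.leftComm K A A B).toAlgHom

theorem swap12_emb13 [Algebra K A] [Algebra K B] (x : A ⊗[K] B) :
    swap12 K A B (emb13 K A A B x) = emb23 K A A B x := by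
  induction x using TensorProduct.induction_on with
  | zero => simp
  | tmul a b => simp [swap12, emb13, emb23]
  | add x y hx hy => simp only [map_add, hx, hy]

theorem swap12_emb23 [Algebra K A] [Algebra K B] (x : A ⊗[K] B) :
    swap12 K A B (emb23 K A A B x) = emb13 K A A B x := by
  induction x using TensorProduct.induction_on with
  | zero => simp
  | tmul a b => simp [swap12, emb13, emb23]
  | add x y hx hy => simp only [map_add, hx, hy]

/-- Interchange of the last two tensor factors. -/
def swap23 (K A B : Type*) [Field K] [Ring A] [Ring B] [Algebra K A] [Algebra K B] :
    A ⊗[K] (B ⊗[K] B) →ₐ[K] A ⊗[K] (B ⊗[K] B) :=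
  Algebra.TensorProduct.map (AlgHom.id K A) (Algebra.TensorProduct.comm K B B).toAlgHom

theorem swap23_emb13 [Algebra K A] [Algebra K B] (x : A ⊗[K] B) :
    swap23 K A B (emb13 K A B B x) = emb12 K A B B x := by
  induction x using TensorProduct.induction_on with
  | zero => simp
  | tmul a b => simp [swap23, emb13, emb12]
  | add x y hx hy => simp only [map_add, hx, hy]

theorem swap23_emb12 [Algebra K A] [Algebra K B] (x : A ⊗[K] B) :
    swap23 K A B (emb12 K A B B x) = emb13 K A B B x := by
  induction x using TensorProduct.induction_on with
  | zero => simp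
  | tmul a b => simp [swap23, emb13, emb12]
  | add x y hx hy => simp only [map_add, hx, hy]

variable [Bialgebra K A] [Bialgebra K B] {r : A ⊗[K] B}

theorem IsQT.emb12_mul_emb13_mul_emb23 {p : A ⊗[K] A} (hp : IsQT K p)
    (hc : TensorProduct.assoc K A A B (TensorProduct.map (comul (R := K)) LinearMap.id r) =
      emb13 K A A B r * emb23 K A A B r) :
    emb12 K A A B p * emb13 K A A B r * emb23 K A A B r =
      emb23 K A A B r * emb13 K A A B r * emb12 K A A B p := by
  have hs := congrArg (swap12 K A B) hc
  rw [map_mul, swap12_emb13, swap12_emb23] at hs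
  rw [mul_assoc, ← hc, ← hs]
  generalize r = x
  induction x using TensorProduct.induction_on with
  | zero => simp
  | tmul a b =>
    have hl : ∀ x y : A ⊗[K] A, emb12 K A A B x * TensorProduct.assoc K A A B (y ⊗ₜ b) =
        TensorProduct.assoc K A A B ((x * y) ⊗ₜ b) := fun x y => by
      induction x using TensorProduct.induction_on with
      | zero => simp
      | tmul c d =>
        induction y using TensorProduct.induction_on with
        | zero => simp
        | tmul e f => simp [emb12]
        | add x y hx hy => simp only [map_add, mul_add, TensorProduct.add_tmul, hx, hy]
      | add x y hx hy => simp only [map_add, add_mul, TensorProduct.add_tmul, hx, hy]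
    have hr : ∀ x y : A ⊗[K] A,
        swap12 K A B (TensorProduct.assoc K A A B (y ⊗ₜ b)) * emb12 K A A B x =
        TensorProduct.assoc K A A B ((TensorProduct.comm K A A y * x) ⊗ₜ b) := fun x y => by
      induction x using TensorProduct.induction_on with
      | zero => simp
      | tmul c d =>
        induction y using TensorProduct.induction_on with
        | zero => simp
        | tmul e f => simp [emb12, swap12]
        | add x y hx hy => simp only [map_add, add_mul, TensorProduct.add_tmul, hx, hy]
      | add x y hx hy => simp only [map_add, mul_add, TensorProduct.add_tmul, hx, hy]
    simp only [TensorProduct.map_tmul, LinearMap.id_coe, id_eq, hl, hr, hp.almost_cocomm]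
  | add x y hx hy => simp only [map_add, mul_add, add_mul, hx, hy]

theorem IsQT.emb12_mul_emb13_mul_emb23' {p : B ⊗[K] B} (hp : IsQT K p)
    (hc : TensorProduct.map LinearMap.id (comul (R := K)) r =
      emb13 K A B B r * emb12 K A B B r) :
    emb12 K A B B r * emb13 K A B B r * emb23 K A B B p =
      emb23 K A B B p * emb13 K A B B r * emb12 K A B B r := by
  have hs := congrArg (swap23 K A B) hc
  rw [map_mul, swap23_emb13, swap23_emb12] at hs
  rw [mul_assoc (emb23 K A B B p), ← hc, ← hs]
  generalize r = x
  induction x using TensorProduct.induction_on with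
  | zero => simp
  | tmul a b =>
    have hr : ∀ y : B ⊗[K] B, swap23 K A B (a ⊗ₜ y) * emb23 K A B B p =
        a ⊗ₜ (TensorProduct.comm K B B y * p) := fun y => by
      simp only [swap23, emb23, Algebra.TensorProduct.map_tmul,
        Algebra.TensorProduct.includeRight_apply, Algebra.TensorProduct.tmul_mul_tmul, mul_one]
      rfl
    have hl : ∀ y : B ⊗[K] B, emb23 K A B B p * (a ⊗ₜ y) = a ⊗ₜ (p * y) := fun y => by
      simp [emb23]
    simp only [TensorProduct.map_tmul, LinearMap.id_coe, id_eq, hl, hr, hp.almost_cocomm]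
  | add x y hx hy => simp only [map_add, mul_add, add_mul, hx, hy]

end Bialgebra

variable {A : Type*} [Ring A] [HopfAlgebra K A] {p : A ⊗[K] A}

theorem IsQT.isWeakR (hp : IsQT K p) : IsWeakR K p where
  isUnit := isUnit_iff_exists.mpr ⟨_,
    mul_map_antipode_left hp.comul_left (map_linearMap_comp_counit_left hp.counit_left),
    map_antipode_left_mul hp.comul_left (map_linearMap_comp_counit_left hp.counit_left)⟩
  comul_left := hp.comul_left
  comul_right := hp.comul_right

/-- The linear map `a ⊗ b ↦ S(b) a`. -/
def antipodeMulFlip (K A : Type*) [Field K] [Ring A] [HopfAlgebra K A] : A ⊗[K] A →ₗ[K] A :=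
  LinearMap.mul' K A ∘ₗ TensorProduct.map (antipode K) LinearMap.id ∘ₗ
    (TensorProduct.comm K A A).toLinearMap

@[simp]
theorem antipodeMulFlip_tmul (a b : A) : antipodeMulFlip K A (a ⊗ₜ b) = antipode K b * a := by
  simp [antipodeMulFlip]

/-- The Drinfeld element `u = S(pⁱ) pᵢ`. -/
def drinfeld (p : A ⊗[K] A) : A := antipodeMulFlip K A p

theorem antipodeMulFlip_comm_comul_mul (a : A) (x : A ⊗[K] A) :
    antipodeMulFlip K A (TensorProduct.comm K A A (comul (R := K) a) * x) =
      counit (R := K) a • antipodeMulFlip K A x := by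
  induction x using TensorProduct.induction_on with
  | zero => simp
  | tmul c d =>
    have key : ∀ y : A ⊗[K] A,
        antipodeMulFlip K A (TensorProduct.comm K A A y * c ⊗ₜ[K] d) =
          antipode K d * LinearMap.mul' K A ((antipode K).rTensor A y) * c := fun y => by
      induction y using TensorProduct.induction_on with
      | zero => simp
      | tmul e f => simp [antipode_mul_antidistrib, mul_assoc]
      | add x y hx hy => simp only [map_add, add_mul, mul_add, hx, hy]
    rw [key, mul_antipode_rTensor_comul_apply]
    simp [Algebra.algebraMap_eq_smul_one]
  | add x y hx hy => simp only [map_add, mul_add, hx, hy, smul_add]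

theorem antipodeMulFlip_mul_tmul (x : A ⊗[K] A) (a b : A) :
    antipodeMulFlip K A (x * a ⊗ₜ[K] b) = antipode K b * antipodeMulFlip K A x * a := by
  induction x using TensorProduct.induction_on with
  | zero => simp
  | tmul c d => simp [antipode_mul_antidistrib, mul_assoc]
  | add x y hx hy => simp only [map_add, mul_add, add_mul, hx, hy]

theorem IsQT.drinfeld_mul (hp : IsQT K p) (a : A) :
    drinfeld p * a = antipode K (antipode K a) * drinfeld p := by
  let Λ : A ⊗[K] (A ⊗[K] A) →ₗ[K] A :=
    LinearMap.mul' K A ∘ₗ (TensorProduct.comm K A A).toLinearMap ∘ₗ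
      TensorProduct.map LinearMap.id
        (LinearMap.mulRight K (drinfeld p) ∘ₗ antipode K ∘ₗ LinearMap.mul' K A ∘ₗ
          (antipode K).lTensor A)
  have hΛ : ∀ x y z : A, Λ (x ⊗ₜ (y ⊗ₜ z)) =
      antipode K (y * antipode K z) * drinfeld p * x := fun x y z => by simp [Λ]
  have h₁ : ∀ x : A ⊗[K] A, Λ ((comul (R := K)).lTensor A x) =
      drinfeld p * TensorProduct.rid K A (counit.lTensor A x) := fun x => by
    induction x using TensorProduct.induction_on with
    | zero => simp
    | tmul c d => simp [Λ, Algebra.algebraMap_eq_smul_one]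
    | add x y hx hy => simp only [map_add, mul_add, hx, hy]
  have h₂ : ∀ x : A ⊗[K] A,
      Λ (TensorProduct.assoc K A A A ((comul (R := K)).rTensor A x)) =
      antipode K (antipode K (TensorProduct.lid K A (counit.rTensor A x))) * drinfeld p :=
      fun x => by
    induction x using TensorProduct.induction_on with
    | zero => simp
    | tmul c d =>
      have key : ∀ y : A ⊗[K] A, Λ (TensorProduct.assoc K A A A (y ⊗ₜ d)) =
          antipode K (antipode K d) * antipodeMulFlip K A (p * y) := fun y => by
        induction y using TensorProduct.induction_on with
        | zero => simp
        | tmul e f =>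
          rw [TensorProduct.assoc_tmul, hΛ, antipodeMulFlip_mul_tmul,
            antipode_mul_antidistrib, drinfeld]
          simp only [mul_assoc]
        | add x y hx hy => simp only [map_add, mul_add, TensorProduct.add_tmul, hx, hy]
      rw [LinearMap.rTensor_tmul, key, ← hp.almost_cocomm, antipodeMulFlip_comm_comul_mul]
      simp [drinfeld]
    | add x y hx hy => simp only [map_add, add_mul, hx, hy]
  have h := h₁ (comul (R := K) a)
  rw [← coassoc_apply, h₂] at h
  simpa using h.symm

theorem IsQT.isUnit_drinfeld (hp : IsQT K p) : IsUnit (drinfeld p) := by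
  have hw := hp.isWeakR
  obtain ⟨s, h1, -⟩ := isUnit_iff_exists.mp hw.isUnit
  let M : A ⊗[K] Aᵐᵒᵖ →ₗ[K] A :=
    LinearMap.mul' K A ∘ₗ (TensorProduct.comm K A A).toLinearMap ∘ₗ
      TensorProduct.map LinearMap.id (MulOpposite.opLinearEquiv K).symm.toLinearMap
  let v : A := LinearMap.mul' K A (TensorProduct.comm K A A
    (TensorProduct.map (antipode K ∘ₗ antipode K) LinearMap.id p))
  have hM : M 1 = 1 := by simp [M, Algebra.TensorProduct.one_def]
  -- `v u = pⁱ u pᵢ = pⁱ S(pʲ) pⱼ pᵢ`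
  have hvu : v * drinfeld p = 1 := by
    have key : ∀ x : A ⊗[K] A,
        LinearMap.mul' K A (TensorProduct.comm K A A
          (TensorProduct.map (antipode K ∘ₗ antipode K) LinearMap.id x)) * drinfeld p =
        M (opify K A A (TensorProduct.map LinearMap.id (antipode K) p) * opify K A A x) := by
      intro x
      induction x using TensorProduct.induction_on with
      | zero => simp
      | tmul a b =>
        have : ∀ y : A ⊗[K] A, b * (antipodeMulFlip K A y * a) =
            M (opify K A A (TensorProduct.map LinearMap.id (antipode K) y) *
              opify K A A (a ⊗ₜ b)) := fun y => by
          induction y using TensorProduct.induction_on with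
          | zero => simp
          | tmul c d => simp [M, opify, mul_assoc]
          | add x y hx hy => simp only [map_add, add_mul, mul_add, hx, hy]
        rw [← this, ← drinfeld, hp.drinfeld_mul]
        simp [mul_assoc]
      | add x y hx hy => simp only [map_add, add_mul, mul_add, hx, hy]
    rw [key, hw.opify_antipode_mul_opify, hM]
  -- `u v = S²(pⁱ) u S²(pᵢ) = S(pⁱ) u S(pᵢ)`
  have huv : drinfeld p * v = 1 := by
    have key : ∀ x : A ⊗[K] A,
        drinfeld p * LinearMap.mul' K A (TensorProduct.comm K A A
          (TensorProduct.map (antipode K ∘ₗ antipode K) LinearMap.id x)) =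
        antipodeMulFlip K A (p * TensorProduct.map (antipode K) LinearMap.id
          (TensorProduct.map (antipode K) (antipode K) x)) := fun x => by
      induction x using TensorProduct.induction_on with
      | zero => simp
      | tmul a b =>
        simp only [TensorProduct.map_tmul, LinearMap.comp_apply, LinearMap.id_coe, id_eq,
          TensorProduct.comm_tmul, LinearMap.mul'_apply, antipodeMulFlip_mul_tmul]
        rw [← mul_assoc, hp.drinfeld_mul, drinfeld]
      | add x y hx hy => simp only [map_add, mul_add, hx, hy]
    rw [key, hw.map_antipode_antipode, hw.map_antipode_left h1, h1]
    simp [Algebra.TensorProduct.one_def]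
  exact isUnit_iff_exists.mpr ⟨v, huv, hvu⟩

theorem IsQT.exists_algEquiv (hp : IsQT K p) : ∃ V : A ≃ₐ[K] A,
    (∀ a : A, antipode K (antipode K (V a)) = a) ∧
      ∀ a : A, V (antipode K (antipode K a)) = a := by
  obtain ⟨u, hu⟩ := hp.isUnit_drinfeld
  have h : ∀ a : A, ↑u * a = antipode K (antipode K a) * ↑u := fun a => by
    rw [hu, hp.drinfeld_mul]
  let V : A ≃ₐ[K] A := AlgEquiv.ofAlgHom
    (AlgHom.ofLinearMap (LinearMap.mulLeft K (↑u⁻¹ : A) ∘ₗ LinearMap.mulRight K (u : A))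
      (by simp) (fun x y => by simp [mul_assoc]))
    (AlgHom.ofLinearMap (LinearMap.mulLeft K (u : A) ∘ₗ LinearMap.mulRight K (↑u⁻¹ : A))
      (by simp) (fun x y => by simp [mul_assoc]))
    (by ext; simp [mul_assoc]) (by ext; simp [mul_assoc])
  have hV : ∀ a, V a = ↑u⁻¹ * (a * u) := fun a => rfl
  refine ⟨V, fun a => u.isUnit.mul_right_cancel ?_, fun a => ?_⟩
  · rw [← h, hV, Units.mul_inv_cancel_left]
  · rw [hV, ← h, Units.inv_mul_cancel_left]

end Quasitriangular

section OrientedConditions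

variable {K : Type*} [Field K] {A B : Type*} [Ring A] [Ring B]
  [HopfAlgebra K A] [HopfAlgebra K B] {r rinv : A ⊗[K] B} {V : A ≃ₐ[K] A} {V' : B ≃ₐ[K] B}

theorem IsWeakR.map_algEquiv (hw : IsWeakR K r)
    (hV : ∀ a : A, V (antipode K (antipode K a)) = a)
    (hV' : ∀ b : B, V' (antipode K (antipode K b)) = b) :
    Algebra.TensorProduct.map V.toAlgHom V'.toAlgHom r = r := by
  have key : ∀ x : A ⊗[K] B, Algebra.TensorProduct.map V.toAlgHom V'.toAlgHom
      (TensorProduct.map (antipode K) (antipode K)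
        (TensorProduct.map (antipode K) (antipode K) x)) = x := fun x => by
    induction x using TensorProduct.induction_on with
    | zero => simp
    | tmul a b => simp [hV, hV']
    | add x y hx hy => simp only [map_add, hx, hy]
  simpa only [hw.map_antipode_antipode] using key r

theorem opify_map_right (x : A ⊗[K] B) :
    opify K A B (Algebra.TensorProduct.map (AlgHom.id K A) V'.toAlgHom x) =
      Algebra.TensorProduct.map (AlgHom.id K A) (AlgHom.op V'.toAlgHom) (opify K A B x) := by
  induction x using TensorProduct.induction_on with
  | zero => simp
  | tmul a b => simp [opify]
  | add x y hx hy => simp only [map_add, hx, hy]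

theorem IsWeakR.opify_map_algEquiv (hw : IsWeakR K r) (h1 : r * rinv = 1)
    (hV' : ∀ b : B, V' (antipode K (antipode K b)) = b) :
    opify K A B (Algebra.TensorProduct.map (AlgHom.id K A) V'.toAlgHom r) =
        Algebra.TensorProduct.map (AlgHom.id K A) (AlgHom.op V'.toAlgHom) (opify K A B r) ∧
      opify K A B rinv = Algebra.TensorProduct.map (AlgHom.id K A) (AlgHom.op V'.toAlgHom)
        (opify K A B (TensorProduct.map LinearMap.id (antipode K) r)) := by
  refine ⟨opify_map_right r, ?_⟩
  have key : ∀ x : A ⊗[K] B, Algebra.TensorProduct.map (AlgHom.id K A) (AlgHom.op V'.toAlgHom)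
      (opify K A B (TensorProduct.map LinearMap.id (antipode K)
        (TensorProduct.map LinearMap.id (antipode K) x))) = opify K A B x := fun x => by
    induction x using TensorProduct.induction_on with
    | zero => simp
    | tmul a b => simp [opify, hV']
    | add x y hx hy => simp only [map_add, hx, hy]
  rw [← key, hw.map_antipode_right h1]

theorem IsWeakR.opify_inv_mul_opify_map (hw : IsWeakR K r) (h1 : r * rinv = 1)
    (hV' : ∀ b : B, V' (antipode K (antipode K b)) = b) :
    opify K A B rinv *
      opify K A B (Algebra.TensorProduct.map (AlgHom.id K A) V'.toAlgHom r) = 1 := by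
  obtain ⟨e₁, e₂⟩ := hw.opify_map_algEquiv h1 hV'
  rw [e₁, e₂, ← map_mul, hw.opify_antipode_mul_opify, map_one]

theorem IsWeakR.opify_map_mul_opify_inv (hw : IsWeakR K r) (h1 : r * rinv = 1)
    (hV' : ∀ b : B, V' (antipode K (antipode K b)) = b) :
    opify K A B (Algebra.TensorProduct.map (AlgHom.id K A) V'.toAlgHom r) *
      opify K A B rinv = 1 := by
  obtain ⟨e₁, e₂⟩ := hw.opify_map_algEquiv h1 hV'
  rw [e₁, e₂, ← map_mul, hw.opify_mul_opify_antipode, map_one]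

theorem IsWeakR.opify_map_left (hw : IsWeakR K r)
    (hV : ∀ a : A, V (antipode K (antipode K a)) = a)
    (hV' : ∀ b : B, V' (antipode K (antipode K b)) = b) :
    opify K A B (Algebra.TensorProduct.map V.toAlgHom (AlgHom.id K B) rinv) =
        Algebra.TensorProduct.map V.toAlgHom (AlgHom.id K Bᵐᵒᵖ) (opify K A B rinv) ∧
      opify K A B r = Algebra.TensorProduct.map V.toAlgHom (AlgHom.id K Bᵐᵒᵖ)
        (opify K A B (Algebra.TensorProduct.map (AlgHom.id K A) V'.toAlgHom r)) := by
  have key : ∀ x : A ⊗[K] B,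
      opify K A B (Algebra.TensorProduct.map V.toAlgHom (AlgHom.id K B) x) =
        Algebra.TensorProduct.map V.toAlgHom (AlgHom.id K Bᵐᵒᵖ) (opify K A B x) := fun x => by
    induction x using TensorProduct.induction_on with
    | zero => simp
    | tmul a b => simp [opify]
    | add x y hx hy => simp only [map_add, hx, hy]
  refine ⟨key _, ?_⟩
  rw [← key]
  conv_lhs => rw [← hw.map_algEquiv hV hV']
  rw [← AlgHom.comp_apply, ← Algebra.TensorProduct.map_comp, AlgHom.comp_id, AlgHom.id_comp]

theorem IsWeakR.opify_map_inv_mul_opify (hw : IsWeakR K r) (h1 : r * rinv = 1)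
    (hV : ∀ a : A, V (antipode K (antipode K a)) = a)
    (hV' : ∀ b : B, V' (antipode K (antipode K b)) = b) :
    opify K A B (Algebra.TensorProduct.map V.toAlgHom (AlgHom.id K B) rinv) *
      opify K A B r = 1 := by
  obtain ⟨e₁, e₂⟩ := hw.opify_map_left (rinv := rinv) hV hV'
  rw [e₁, e₂, ← map_mul, hw.opify_inv_mul_opify_map h1 hV', map_one]

theorem IsWeakR.opify_mul_opify_map_inv (hw : IsWeakR K r) (h1 : r * rinv = 1)
    (hV : ∀ a : A, V (antipode K (antipode K a)) = a)
    (hV' : ∀ b : B, V' (antipode K (antipode K b)) = b) :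
    opify K A B r *
      opify K A B (Algebra.TensorProduct.map V.toAlgHom (AlgHom.id K B) rinv) = 1 := by
  obtain ⟨e₁, e₂⟩ := hw.opify_map_left (rinv := rinv) hV hV'
  rw [e₁, e₂, ← map_mul, hw.opify_map_mul_opify_inv h1 hV', map_one]

end OrientedConditions

section MonoidIdentity

variable {M : Type*} [Monoid M]

/-- Passing from `r₁ r₂ q = q r₂ r₁` to the relation for the inverses of `r₁` and `r₂`. -/
theorem inv_mul_inv_mul_eq {r₁ r₂ s₁ s₂ q : M} (h₁ : r₁ * s₁ = 1) (h₁' : s₁ * r₁ = 1)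
    (h₂ : r₂ * s₂ = 1) (h₂' : s₂ * r₂ = 1) (h : q * r₁ * r₂ = r₂ * r₁ * q) :
    s₁ * s₂ * q = q * s₂ * s₁ := by
  calc s₁ * s₂ * q = s₁ * s₂ * (q * r₁ * r₂) * (s₂ * s₁) := by
        simp only [mul_assoc, mul_one, h₁, ← mul_assoc r₂ s₂, h₂, one_mul]
    _ = s₁ * (s₂ * r₂) * r₁ * q * (s₂ * s₁) := by rw [h]; simp only [mul_assoc]
    _ = q * s₂ * s₁ := by rw [h₂', mul_one, h₁', one_mul, mul_assoc]

/-- Moving only one inverse through the relation `q r₁ r₂ = r₂ r₁ q`. -/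
theorem mul_mul_inv_eq {r₁ r₂ s₁ q : M} (h₁ : r₁ * s₁ = 1) (h₁' : s₁ * r₁ = 1)
    (h : r₁ * r₂ * q = q * r₂ * r₁) : r₂ * q * s₁ = s₁ * q * r₂ := by
  calc r₂ * q * s₁ = s₁ * (r₁ * r₂ * q) * s₁ := by
        simp only [mul_assoc, ← mul_assoc s₁ r₁, h₁', one_mul]
    _ = s₁ * q * r₂ := by rw [h]; simp only [mul_assoc, h₁, mul_one]

/-- The word identity behind the quantum Yang–Baxter equation for `[p, p']`; the indices
record tensor positions. -/
theorem qybe_word {r14 r16 r36 s32 s52 s54 p13 p15 p35 q24 q26 q46 : M}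
    (hp : p13 * p15 * p35 = p35 * p15 * p13)
    (hq : q24 * q26 * q46 = q46 * q26 * q24)
    (h1 : p13 * r16 * r36 = r36 * r16 * p13)
    (h2 : r14 * r16 * q46 = q46 * r16 * r14)
    (h3 : r36 * q26 * s32 = s32 * q26 * r36)
    (h4 : r14 * p15 * s54 = s54 * p15 * r14)
    (h5 : s32 * s52 * p35 = p35 * s52 * s32)
    (h6 : s54 * s52 * q24 = q24 * s52 * s54)
    (c1 : Commute s32 r16) (c2 : Commute s32 p15) (c3 : Commute s52 r36)
    (c4 : Commute p15 r36) (c5 : Commute q24 r16) (c6 : Commute q24 p15)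
    (c7 : Commute q24 r36) (c8 : Commute s52 q46) (c9 : Commute s32 q46)
    (c10 : Commute q26 p35) (c11 : Commute q24 p35)
    (c12 : Commute r14 r36) (c13 : Commute s32 s54)
    (c14 : Commute s54 r16) (c15 : Commute s54 q26) (c16 : Commute r14 s52)
    (c17 : Commute r14 q26) (c18 : Commute s52 p13) (c19 : Commute s54 p13)
    (c20 : Commute p35 r14) (c21 : Commute p35 r16)
    (c22 : Commute p15 q46) (c23 : Commute q26 p13) (c24 : Commute q46 p13) :
    (r14 * p13 * q24 * s32) * (r16 * p15 * q26 * s52) * (r36 * p35 * q46 * s54) =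
      (r36 * p35 * q46 * s54) * (r16 * p15 * q26 * s52) * (r14 * p13 * q24 * s32) := by
  have hl : (r14 * p13 * q24 * s32) * (r16 * p15 * q26 * s52) * (r36 * p35 * q46 * s54) =
      r14 * r36 * r16 * (p13 * p15 * p35) * (q24 * q26 * q46) * (s52 * s54 * s32) := by
    calc _ = r14 * p13 * q24 * r16 * p15 * (s32 * q26 * r36) * s52 * p35 * q46 * s54 := by
          simp only [mul_assoc, c1.left_comm, c2.left_comm, c3.left_comm]
      _ = r14 * p13 * q24 * r16 * p15 * r36 * q26 * (s32 * s52 * p35) * q46 * s54 := by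
          rw [← h3]; simp only [mul_assoc]
      _ = r14 * (p13 * r16 * r36) * p15 * p35 * q24 * q26 * q46 * s52 * s54 * s32 := by
          rw [h5]
          simp only [mul_assoc, c4.left_comm, c5.left_comm, c6.left_comm, c7.left_comm,
            c8.left_comm, c9.left_comm, c10.left_comm, c11.left_comm, c13.eq]
      _ = _ := by rw [h1]; simp only [mul_assoc]
  have hr : (r36 * p35 * q46 * s54) * (r16 * p15 * q26 * s52) * (r14 * p13 * q24 * s32) =
      r36 * r14 * r16 * (p35 * p15 * p13) * (q46 * q26 * q24) * (s52 * s54 * s32) := by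
    calc _ = r36 * p35 * q46 * r16 * (s54 * p15 * r14) * q26 * p13 * s52 * q24 * s32 := by
          simp only [mul_assoc, c14.left_comm, c16.symm.left_comm, c17.symm.left_comm,
            c18.left_comm]
      _ = r36 * p35 * q46 * r16 * r14 * p15 * q26 * p13 * (s54 * s52 * q24) * s32 := by
          rw [← h4]; simp only [mul_assoc, c15.left_comm, c19.left_comm]
      _ = r36 * p35 * (q46 * r16 * r14) * p15 * q26 * p13 * q24 * s52 * s54 * s32 := by
          rw [h6]; simp only [mul_assoc]
      _ = _ := by
          rw [← h2]
          simp only [mul_assoc, c20.left_comm, c21.left_comm, c22.symm.left_comm,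
            c23.left_comm, c24.left_comm]
  rw [hl, hr, hp, hq, c12.eq]

end MonoidIdentity

section Qybe

variable {K : Type*} [Field K] {A B C X : Type*} [Ring A] [Ring B] [Ring C] [Ring X]
  [Algebra K A] [Algebra K B] [Algebra K C] [Algebra K X]

theorem commute_lift {D : Type*} [Ring D] [Algebra K D]
    {f : A →ₐ[K] X} {g : B →ₐ[K] X} {h : C →ₐ[K] X} {k : D →ₐ[K] X}
    (fg : ∀ a b, Commute (f a) (g b)) (hk : ∀ a b, Commute (h a) (k b))
    (fh : ∀ a b, Commute (f a) (h b)) (fk : ∀ a b, Commute (f a) (k b))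
    (gh : ∀ a b, Commute (g a) (h b)) (gk : ∀ a b, Commute (g a) (k b))
    (x : A ⊗[K] B) (y : C ⊗[K] D) :
    Commute (Algebra.TensorProduct.lift f g fg x) (Algebra.TensorProduct.lift h k hk y) := by
  induction x using TensorProduct.induction_on with
  | zero => simp
  | tmul a b =>
    induction y using TensorProduct.induction_on with
    | zero => simp
    | tmul c d =>
      simp only [Algebra.TensorProduct.lift_tmul]
      exact ((fh a c).mul_right (fk a d)).mul_left ((gh b c).mul_right (gk b d))
    | add x y hx hy => rw [map_add]; exact hx.add_right hy
  | add x y hx hy => rw [map_add]; exact hx.add_left hy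

/-- A three-term relation in `A ⊗ (B ⊗ C)` holds for any three pairwise commuting
algebra maps. -/
theorem lift_relation {f : A →ₐ[K] X} {g : B →ₐ[K] X} {h : C →ₐ[K] X}
    (fg : ∀ a b, Commute (f a) (g b)) (fh : ∀ a b, Commute (f a) (h b))
    (gh : ∀ a b, Commute (g a) (h b)) {x : A ⊗[K] B} {y : A ⊗[K] C} {z : B ⊗[K] C}
    (H : emb12 K A B C x * emb13 K A B C y * emb23 K A B C z =
      emb23 K A B C z * emb13 K A B C y * emb12 K A B C x) :
    Algebra.TensorProduct.lift f g fg x * Algebra.TensorProduct.lift f h fh y *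
        Algebra.TensorProduct.lift g h gh z =
      Algebra.TensorProduct.lift g h gh z * Algebra.TensorProduct.lift f h fh y *
        Algebra.TensorProduct.lift f g fg x := by
  have hc : ∀ a (b : B ⊗[K] C), Commute (f a) (Algebra.TensorProduct.lift g h gh b) := by
    intro a b
    induction b using TensorProduct.induction_on with
    | zero => simp
    | tmul b c => rw [Algebra.TensorProduct.lift_tmul]; exact (fg a b).mul_right (fh a c)
    | add x y hx hy => rw [map_add]; exact hx.add_right hy
  let L := Algebra.TensorProduct.lift f (Algebra.TensorProduct.lift g h gh) hc
  have e12 : L.comp (emb12 K A B C) = Algebra.TensorProduct.lift f g fg := by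
    ext <;> simp [L, emb12]
  have e13 : L.comp (emb13 K A B C) = Algebra.TensorProduct.lift f h fh := by
    ext <;> simp [L, emb13]
  have e23 : L.comp (emb23 K A B C) = Algebra.TensorProduct.lift g h gh := by
    ext <;> simp [L, emb23]
  have := congrArg L H
  simpa only [map_mul, ← e12, ← e13, ← e23, AlgHom.comp_apply] using this

/-- The Yang–Baxter equation for `[p, p']`, with the tensor positions `1, 3, 5` given by
`f 0, f 1, f 2` and the positions `2, 4, 6` by `g 0, g 1, g 2`. -/
theorem qybe_lift {p : A ⊗[K] A} {p' : B ⊗[K] B} {r rinv : A ⊗[K] B}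
    (h1 : r * rinv = 1) (h2 : rinv * r = 1)
    (hp : emb12 K A A A p * emb13 K A A A p * emb23 K A A A p =
      emb23 K A A A p * emb13 K A A A p * emb12 K A A A p)
    (hp' : emb12 K B B B p' * emb13 K B B B p' * emb23 K B B B p' =
      emb23 K B B B p' * emb13 K B B B p' * emb12 K B B B p')
    (h3 : emb12 K A A B p * emb13 K A A B r * emb23 K A A B r =
      emb23 K A A B r * emb13 K A A B r * emb12 K A A B p)
    (h4 : emb12 K A B B r * emb13 K A B B r * emb23 K A B B p' =
      emb23 K A B B p' * emb13 K A B B r * emb12 K A B B r)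
    {f : Fin 3 → A →ₐ[K] X} {g : Fin 3 → B →ₐ[K] X}
    (ff : ∀ i j, i ≠ j → ∀ a b, Commute (f i a) (f j b))
    (fg : ∀ i j a b, Commute (f i a) (g j b))
    (gg : ∀ i j, i ≠ j → ∀ a b, Commute (g i a) (g j b))
    {β : ∀ i j : Fin 3, i ≠ j → X}
    (hβ : ∀ i j h, β i j h =
      Algebra.TensorProduct.lift (f i) (g j) (fg i j) r *
        Algebra.TensorProduct.lift (f i) (f j) (ff i j h) p *
        Algebra.TensorProduct.lift (g i) (g j) (gg i j h) p' *
        Algebra.TensorProduct.lift (f j) (g i) (fg j i) rinv) :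
    β 0 1 (by decide) * β 0 2 (by decide) * β 1 2 (by decide) =
      β 1 2 (by decide) * β 0 2 (by decide) * β 0 1 (by decide) := by
  have rr : ∀ {i j k l} (x y : A ⊗[K] B), i ≠ k → j ≠ l →
      Commute (Algebra.TensorProduct.lift (f i) (g j) (fg i j) x)
        (Algebra.TensorProduct.lift (f k) (g l) (fg k l) y) := fun {i j k l} x y hik hjl =>
    commute_lift _ _ (ff i k hik) (fg i l) (fun a b => (fg k j b a).symm) (gg j l hjl) x y
  have rp : ∀ {i j k l} (h : k ≠ l) (x : A ⊗[K] B) (y : A ⊗[K] A), i ≠ k → i ≠ l →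
      Commute (Algebra.TensorProduct.lift (f i) (g j) (fg i j) x)
        (Algebra.TensorProduct.lift (f k) (f l) (ff k l h) y) := fun {i j k l} h x y hik hil =>
    commute_lift _ _ (ff i k hik) (ff i l hil) (fun a b => (fg k j b a).symm)
      (fun a b => (fg l j b a).symm) x y
  have rq : ∀ {i j k l} (h : k ≠ l) (x : A ⊗[K] B) (y : B ⊗[K] B), j ≠ k → j ≠ l →
      Commute (Algebra.TensorProduct.lift (f i) (g j) (fg i j) x)
        (Algebra.TensorProduct.lift (g k) (g l) (gg k l h) y) := fun {i j k l} h x y hjk hjl =>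
    commute_lift _ _ (fg i k) (fg i l) (gg j k hjk) (gg j l hjl) x y
  have pq : ∀ {i j k l} (h : i ≠ j) (h' : k ≠ l) (x : A ⊗[K] A) (y : B ⊗[K] B),
      Commute (Algebra.TensorProduct.lift (f i) (f j) (ff i j h) x)
        (Algebra.TensorProduct.lift (g k) (g l) (gg k l h') y) := fun {i j k l} h h' x y =>
    commute_lift _ _ (fg i k) (fg i l) (fg j k) (fg j l) x y
  have inv : ∀ i j, Algebra.TensorProduct.lift (f i) (g j) (fg i j) r *
      Algebra.TensorProduct.lift (f i) (g j) (fg i j) rinv = 1 := fun i j => by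
    rw [← map_mul, h1, map_one]
  have inv' : ∀ i j, Algebra.TensorProduct.lift (f i) (g j) (fg i j) rinv *
      Algebra.TensorProduct.lift (f i) (g j) (fg i j) r = 1 := fun i j => by
    rw [← map_mul, h2, map_one]
  have n01 : (0 : Fin 3) ≠ 1 := by decide
  have n02 : (0 : Fin 3) ≠ 2 := by decide
  have n12 : (1 : Fin 3) ≠ 2 := by decide
  simp only [hβ]
  exact qybe_word
    (lift_relation (ff 0 1 n01) (ff 0 2 n02) (ff 1 2 n12) hp)
    (lift_relation (gg 0 1 n01) (gg 0 2 n02) (gg 1 2 n12) hp')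
    (lift_relation (ff 0 1 n01) (fg 0 2) (fg 1 2) h3)
    (lift_relation (fg 0 1) (fg 0 2) (gg 1 2 n12) h4)
    (mul_mul_inv_eq (inv 1 0) (inv' 1 0)
      (lift_relation (fg 1 0) (fg 1 2) (gg 0 2 n02) h4))
    (mul_mul_inv_eq (inv 2 1) (inv' 2 1)
      (lift_relation (ff 0 2 n02) (fg 0 1) (fg 2 1) h3).symm)
    (inv_mul_inv_mul_eq (inv 1 0) (inv' 1 0) (inv 2 0) (inv' 2 0)
      (lift_relation (ff 1 2 n12) (fg 1 0) (fg 2 0) h3))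
    (inv_mul_inv_mul_eq (inv 2 1) (inv' 2 1) (inv 2 0) (inv' 2 0)
      (lift_relation (fg 2 0) (fg 2 1) (gg 0 1 n01) h4).symm)
    (rr _ _ n01.symm n02) (rp n02 _ _ n01.symm n12) (rr _ _ n12.symm n02)
    (rp n02 _ _ n01.symm n12).symm (rq n01 _ _ n02.symm n12.symm).symm (pq n02 n01 _ _).symm
    (rq n01 _ _ n02.symm n12.symm).symm (rq n12 _ _ n01 n02) (rq n12 _ _ n01 n02)
    (pq n12 n02 _ _).symm (pq n12 n01 _ _).symm
    (rr _ _ n01 n12) (rr _ _ n12 n01)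
    (rr _ _ n02.symm n12) (rq n02 _ _ n01.symm n12) (rr _ _ n02 n01.symm)
    (rq n02 _ _ n01.symm n12) (rp n01 _ _ n02.symm n12.symm) (rp n01 _ _ n02.symm n12.symm)
    (rp n12 _ _ n01 n02).symm (rp n12 _ _ n01 n02).symm
    (pq n02 n12 _ _) (pq n01 n02 _ _).symm (pq n01 n12 _ _).symm

/-- The three embeddings of an algebra into its threefold tensor power. -/
def tripleEmb (K H : Type*) [Field K] [Ring H] [Algebra K H] :
    Fin 3 → H →ₐ[K] H ⊗[K] (H ⊗[K] H) :=
  ![Algebra.TensorProduct.includeLeft,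
    Algebra.TensorProduct.includeRight.comp Algebra.TensorProduct.includeLeft,
    Algebra.TensorProduct.includeRight.comp Algebra.TensorProduct.includeRight]

theorem commute_tripleEmb {H : Type*} [Ring H] [Algebra K H] {i j : Fin 3} (h : i ≠ j)
    (a b : H) : Commute (tripleEmb K H i a) (tripleEmb K H j b) := by
  fin_cases i <;> fin_cases j <;> first | exact absurd rfl h | simp [tripleEmb, Commute, SemiconjBy]

theorem emb12_eq_lift {H : Type*} [Ring H] [Algebra K H] :
    emb12 K H H H = Algebra.TensorProduct.lift (tripleEmb K H 0) (tripleEmb K H 1)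
      (commute_tripleEmb (by decide)) := by
  ext <;> simp [emb12, tripleEmb]

theorem emb13_eq_lift {H : Type*} [Ring H] [Algebra K H] :
    emb13 K H H H = Algebra.TensorProduct.lift (tripleEmb K H 0) (tripleEmb K H 2)
      (commute_tripleEmb (by decide)) := by
  ext <;> simp [emb13, tripleEmb]

theorem emb23_eq_lift {H : Type*} [Ring H] [Algebra K H] :
    emb23 K H H H = Algebra.TensorProduct.lift (tripleEmb K H 1) (tripleEmb K H 2)
      (commute_tripleEmb (by decide)) := by
  ext <;> simp [emb23, tripleEmb]

theorem commute_includeLeft_includeRight (a : A) (b : B) :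
    Commute ((Algebra.TensorProduct.includeLeft : A →ₐ[K] A ⊗[K] B) a)
      ((Algebra.TensorProduct.includeRight : B →ₐ[K] A ⊗[K] B) b) := by
  simp [Commute, SemiconjBy]

/-- The Yang–Baxter equation for `[p, p']`. -/
theorem qybe_bracket {p : A ⊗[K] A} {p' : B ⊗[K] B} {r rinv : A ⊗[K] B}
    (h1 : r * rinv = 1) (h2 : rinv * r = 1)
    (hp : emb12 K A A A p * emb13 K A A A p * emb23 K A A A p =
      emb23 K A A A p * emb13 K A A A p * emb12 K A A A p)
    (hp' : emb12 K B B B p' * emb13 K B B B p' * emb23 K B B B p' =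
      emb23 K B B B p' * emb13 K B B B p' * emb12 K B B B p')
    (h3 : emb12 K A A B p * emb13 K A A B r * emb23 K A A B r =
      emb23 K A A B r * emb13 K A A B r * emb12 K A A B p)
    (h4 : emb12 K A B B r * emb13 K A B B r * emb23 K A B B p' =
      emb23 K A B B p' * emb13 K A B B r * emb12 K A B B r)
    {α : (A ⊗[K] B) ⊗[K] (A ⊗[K] B)}
    (hα : α = E14 K A B A B r * E13 K A B A B p * E24 K A B A B p' * E32 K A B A B rinv) :
    emb12 K _ _ _ α * emb13 K _ _ _ α * emb23 K _ _ _ α =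
      emb23 K _ _ _ α * emb13 K _ _ _ α * emb12 K _ _ _ α := by
  let e := tripleEmb K (A ⊗[K] B)
  let f : Fin 3 → A →ₐ[K] _ := fun i => (e i).comp Algebra.TensorProduct.includeLeft
  let g : Fin 3 → B →ₐ[K] _ := fun i => (e i).comp Algebra.TensorProduct.includeRight
  have ff : ∀ i j, i ≠ j → ∀ a b, Commute (f i a) (f j b) := fun i j h a b =>
    commute_tripleEmb h _ _
  have gg : ∀ i j, i ≠ j → ∀ a b, Commute (g i a) (g j b) := fun i j h a b =>
    commute_tripleEmb h _ _
  have fg : ∀ i j a b, Commute (f i a) (g j b) := fun i j a b => by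
    by_cases h : i = j
    · subst h
      exact (commute_includeLeft_includeRight a b).map (e i)
    · exact commute_tripleEmb h _ _
  have E : ∀ i j (h : i ≠ j),
      (Algebra.TensorProduct.lift (e i) (e j) (commute_tripleEmb h)) α =
      Algebra.TensorProduct.lift (f i) (g j) (fg i j) r *
        Algebra.TensorProduct.lift (f i) (f j) (ff i j h) p *
        Algebra.TensorProduct.lift (g i) (g j) (gg i j h) p' *
        Algebra.TensorProduct.lift (f j) (g i) (fg j i) rinv := fun i j h => by
    let L := Algebra.TensorProduct.lift (e i) (e j) (commute_tripleEmb h)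
    have e14 : L.comp (E14 K A B A B) = Algebra.TensorProduct.lift (f i) (g j) (fg i j) := by
      ext <;> simp [L, E14, f, g, ← Algebra.TensorProduct.one_def]
    have e13 : L.comp (E13 K A B A B) =
        Algebra.TensorProduct.lift (f i) (f j) (ff i j h) := by
      ext <;> simp [L, E13, f, ← Algebra.TensorProduct.one_def]
    have e24 : L.comp (E24 K A B A B) =
        Algebra.TensorProduct.lift (g i) (g j) (gg i j h) := by
      ext <;> simp [L, E24, g, ← Algebra.TensorProduct.one_def]
    have e32 : L.comp (E32 K A B A B) = Algebra.TensorProduct.lift (f j) (g i) (fg j i) := by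
      ext <;> simp [L, E32, E23, f, g, ← Algebra.TensorProduct.one_def]
    rw [← e14, ← e13, ← e24, ← e32, hα]
    simp only [map_mul, AlgHom.comp_apply, L]
  rw [emb12_eq_lift, emb13_eq_lift, emb23_eq_lift]
  exact qybe_lift h1 h2 hp hp' h3 h4 ff fg gg E

end Qybe

section OppositeProduct

variable {K : Type*} [Field K] {A B : Type*} [Ring A] [Ring B] [Algebra K A] [Algebra K B]

/-- `a ⊗ b ↦ (a ⊗ 1) ⊗ (1 ⊗ b)`. -/
def opE14 (K A B : Type*) [Field K] [Ring A] [Ring B] [Algebra K A] [Algebra K B] :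
    A ⊗[K] Bᵐᵒᵖ →ₐ[K] (A ⊗[K] B) ⊗[K] (A ⊗[K] B)ᵐᵒᵖ :=
  Algebra.TensorProduct.map Algebra.TensorProduct.includeLeft
    (AlgHom.op Algebra.TensorProduct.includeRight)

/-- `a ⊗ c ↦ (a ⊗ 1) ⊗ (c ⊗ 1)`. -/
def opE13 (K A B : Type*) [Field K] [Ring A] [Ring B] [Algebra K A] [Algebra K B] :
    A ⊗[K] Aᵐᵒᵖ →ₐ[K] (A ⊗[K] B) ⊗[K] (A ⊗[K] B)ᵐᵒᵖ :=
  Algebra.TensorProduct.map Algebra.TensorProduct.includeLeft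
    (AlgHom.op Algebra.TensorProduct.includeLeft)

/-- `b ⊗ d ↦ (1 ⊗ b) ⊗ (1 ⊗ d)`. -/
def opE24 (K A B : Type*) [Field K] [Ring A] [Ring B] [Algebra K A] [Algebra K B] :
    B ⊗[K] Bᵐᵒᵖ →ₐ[K] (A ⊗[K] B) ⊗[K] (A ⊗[K] B)ᵐᵒᵖ :=
  Algebra.TensorProduct.map Algebra.TensorProduct.includeRight
    (AlgHom.op Algebra.TensorProduct.includeRight)

/-- The antimultiplicative map `c ⊗ b ↦ (1 ⊗ b) ⊗ (c ⊗ 1)`. -/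
def opE32 (K A B : Type*) [Field K] [Ring A] [Ring B] [Algebra K A] [Algebra K B] :
    A ⊗[K] Bᵐᵒᵖ →ₗ[K] (A ⊗[K] B) ⊗[K] (A ⊗[K] B)ᵐᵒᵖ :=
  opify K (A ⊗[K] B) (A ⊗[K] B) ∘ₗ (E32 K A B A B).toLinearMap ∘ₗ
    TensorProduct.map LinearMap.id (MulOpposite.opLinearEquiv K).symm.toLinearMap

theorem opE32_mul (x y : A ⊗[K] Bᵐᵒᵖ) :
    opE32 K A B (x * y) = opE32 K A B y * opE32 K A B x := by
  induction x using TensorProduct.induction_on with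
  | zero => simp
  | tmul a b =>
    induction y using TensorProduct.induction_on with
    | zero => simp
    | tmul c d => simp [opE32, opify, E32, E23, ← MulOpposite.op_mul]
    | add x y hx hy => simp only [map_add, mul_add, add_mul, hx, hy]
  | add x y hx hy => simp only [map_add, mul_add, add_mul, hx, hy]

theorem opE32_one : opE32 K A B 1 = 1 := by
  simp [opE32, opify, E32, E23, Algebra.TensorProduct.one_def]
  rfl

theorem opify_bracket (r s : A ⊗[K] B) (p : A ⊗[K] A) (q : B ⊗[K] B) :
    opify K (A ⊗[K] B) (A ⊗[K] B)
        (E14 K A B A B r * E13 K A B A B p * E24 K A B A B q * E32 K A B A B s) =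
      opE24 K A B (opify K B B q) * opE32 K A B (opify K A B s) *
        opE14 K A B (opify K A B r) * opE13 K A B (opify K A A p) := by
  induction r using TensorProduct.induction_on with
  | zero => simp
  | add x y hx hy => simp only [map_add, mul_add, add_mul, hx, hy]
  | tmul a b =>
    induction s using TensorProduct.induction_on with
    | zero => simp
    | add x y hx hy => simp only [map_add, mul_add, add_mul, hx, hy]
    | tmul c d =>
      induction p using TensorProduct.induction_on with
      | zero => simp
      | add x y hx hy => simp only [map_add, mul_add, add_mul, hx, hy]
      | tmul e f =>
        induction q using TensorProduct.induction_on with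
        | zero => simp
        | add x y hx hy => simp only [map_add, mul_add, add_mul, hx, hy]
        | tmul g h =>
          simp [opE32, opE14, opE13, opE24, opify, E32, E23, E14, E13, E24,
            ← MulOpposite.op_mul]

theorem opify_bracket_inv (r s : A ⊗[K] B) (p : A ⊗[K] A) (q : B ⊗[K] B) :
    opify K (A ⊗[K] B) (A ⊗[K] B)
        (E32 K A B A B s * E24 K A B A B q * E13 K A B A B p * E14 K A B A B r) =
      opE13 K A B (opify K A A p) * opE14 K A B (opify K A B r) *
        opE32 K A B (opify K A B s) * opE24 K A B (opify K B B q) := by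
  induction r using TensorProduct.induction_on with
  | zero => simp
  | add x y hx hy => simp only [map_add, mul_add, add_mul, hx, hy]
  | tmul a b =>
    induction s using TensorProduct.induction_on with
    | zero => simp
    | add x y hx hy => simp only [map_add, mul_add, add_mul, hx, hy]
    | tmul c d =>
      induction p using TensorProduct.induction_on with
      | zero => simp
      | add x y hx hy => simp only [map_add, mul_add, add_mul, hx, hy]
      | tmul e f =>
        induction q using TensorProduct.induction_on with
        | zero => simp
        | add x y hx hy => simp only [map_add, mul_add, add_mul, hx, hy]
        | tmul g h =>
          simp [opE32, opE14, opE13, opE24, opify, E32, E23, E14, E13, E24,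
            ← MulOpposite.op_mul]

end OppositeProduct

section Naturality

variable {K : Type*} [Field K] {A B : Type*} [Ring A] [Ring B] [Algebra K A] [Algebra K B]

/-- Naturality of `[p, p']` in algebra maps on the first and second halves. -/
theorem map_bracket (f g : A →ₐ[K] A) (f' g' : B →ₐ[K] B)
    (r s : A ⊗[K] B) (p : A ⊗[K] A) (q : B ⊗[K] B) :
    Algebra.TensorProduct.map (Algebra.TensorProduct.map f f')
        (Algebra.TensorProduct.map g g')
        (E14 K A B A B r * E13 K A B A B p * E24 K A B A B q * E32 K A B A B s) =
      E14 K A B A B (Algebra.TensorProduct.map f g' r) *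
        E13 K A B A B (Algebra.TensorProduct.map f g p) *
        E24 K A B A B (Algebra.TensorProduct.map f' g' q) *
        E32 K A B A B (Algebra.TensorProduct.map g f' s) := by
  let L := Algebra.TensorProduct.map (Algebra.TensorProduct.map f f')
    (Algebra.TensorProduct.map g g')
  have e14 : L.comp (E14 K A B A B) =
      (E14 K A B A B).comp (Algebra.TensorProduct.map f g') := by
    ext <;> simp [L, E14]
  have e13 : L.comp (E13 K A B A B) =
      (E13 K A B A B).comp (Algebra.TensorProduct.map f g) := by
    ext <;> simp [L, E13]
  have e24 : L.comp (E24 K A B A B) =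
      (E24 K A B A B).comp (Algebra.TensorProduct.map f' g') := by
    ext <;> simp [L, E24]
  have e32 : L.comp (E32 K A B A B) =
      (E32 K A B A B).comp (Algebra.TensorProduct.map g f') := by
    ext <;> simp [L, E32, E23]
  simp only [map_mul, ← AlgHom.comp_apply]
  simp only [← e14, ← e13, ← e24, ← e32, L]

end Naturality

/-- A product of four factors times the reversed product of their inverses. -/
theorem mul_four_mul_inv {M : Type*} [Monoid M] {a b c d a' b' c' d' : M} (ha : a * a' = 1)
    (hb : b * b' = 1) (hc : c * c' = 1) (hd : d * d' = 1) :
    a * b * c * d * (d' * c' * b' * a') = 1 := by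
  simp only [mul_assoc, ← mul_assoc d d', hd, one_mul, ← mul_assoc c c', hc, ← mul_assoc b b',
    hb, ha]

section Assembly

variable {K : Type*} [Field K] {A B : Type*} [Ring A] [Ring B] [Algebra K A] [Algebra K B]

theorem map_refl_id (x : A ⊗[K] B) :
    Algebra.TensorProduct.map (AlgEquiv.refl : A ≃ₐ[K] A).toAlgHom (AlgHom.id K B) x = x :=
  DFunLike.congr_fun (Algebra.TensorProduct.map_id (R := K) (S := K) (A := A) (B := B)) x

theorem map_refl_refl (x : A ⊗[K] B) :
    Algebra.TensorProduct.map (AlgEquiv.refl : A ≃ₐ[K] A).toAlgHom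
      (AlgEquiv.refl : B ≃ₐ[K] B).toAlgHom x = x :=
  map_refl_id x

/-- `[p, p']` is an oriented quantum algebra structure as soon as `p`, `p'` and `r` satisfy
the orientation conditions and the mixed Yang–Baxter relations. -/
theorem isOQA_bracket {p q : A ⊗[K] A} {p' q' : B ⊗[K] B} {r rinv : A ⊗[K] B}
    {V : A ≃ₐ[K] A} {V' : B ≃ₐ[K] B}
    (h1 : r * rinv = 1) (h2 : rinv * r = 1) (hpq : p * q = 1) (hqp : q * p = 1)
    (hpq' : p' * q' = 1) (hqp' : q' * p' = 1)
    (hp₁ : opify K A A q *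
      opify K A A (Algebra.TensorProduct.map (AlgHom.id K A) V.toAlgHom p) = 1)
    (hp₂ : opify K A A (Algebra.TensorProduct.map (AlgHom.id K A) V.toAlgHom p) *
      opify K A A q = 1)
    (hp'₁ : opify K B B q' *
      opify K B B (Algebra.TensorProduct.map (AlgHom.id K B) V'.toAlgHom p') = 1)
    (hp'₂ : opify K B B (Algebra.TensorProduct.map (AlgHom.id K B) V'.toAlgHom p') *
      opify K B B q' = 1)
    (hr₁ : opify K A B rinv *
      opify K A B (Algebra.TensorProduct.map (AlgHom.id K A) V'.toAlgHom r) = 1)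
    (hr₂ : opify K A B (Algebra.TensorProduct.map (AlgHom.id K A) V'.toAlgHom r) *
      opify K A B rinv = 1)
    (hr₃ : opify K A B (Algebra.TensorProduct.map V.toAlgHom (AlgHom.id K B) rinv) *
      opify K A B r = 1)
    (hr₄ : opify K A B r *
      opify K A B (Algebra.TensorProduct.map V.toAlgHom (AlgHom.id K B) rinv) = 1)
    (hp₃ : Algebra.TensorProduct.map V.toAlgHom V.toAlgHom p = p)
    (hp'₃ : Algebra.TensorProduct.map V'.toAlgHom V'.toAlgHom p' = p')
    (hr₅ : Algebra.TensorProduct.map V.toAlgHom V'.toAlgHom r = r)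
    (hp : emb12 K A A A p * emb13 K A A A p * emb23 K A A A p =
      emb23 K A A A p * emb13 K A A A p * emb12 K A A A p)
    (hp' : emb12 K B B B p' * emb13 K B B B p' * emb23 K B B B p' =
      emb23 K B B B p' * emb13 K B B B p' * emb12 K B B B p')
    (h3 : emb12 K A A B p * emb13 K A A B r * emb23 K A A B r =
      emb23 K A A B r * emb13 K A A B r * emb12 K A A B p)
    (h4 : emb12 K A B B r * emb13 K A B B r * emb23 K A B B p' =
      emb23 K A B B p' * emb13 K A B B r * emb12 K A B B r) :
    IsOQA K (E14 K A B A B r * E13 K A B A B p * E24 K A B A B p' * E32 K A B A B rinv)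
      (E32 K A B A B r * E24 K A B A B q' * E13 K A B A B q * E14 K A B A B rinv)
      AlgEquiv.refl (Algebra.TensorProduct.congr V V') := by
  have hU : (Algebra.TensorProduct.congr V V').toAlgHom =
      Algebra.TensorProduct.map V.toAlgHom V'.toAlgHom := rfl
  have hrinv : Algebra.TensorProduct.map V.toAlgHom V'.toAlgHom rinv = rinv := by
    have h := congrArg (Algebra.TensorProduct.map V.toAlgHom V'.toAlgHom) h2
    rw [map_mul, map_one, hr₅] at h
    exact left_inv_eq_right_inv h h1
  have hmap := map_bracket (AlgHom.id K A) V.toAlgHom (AlgHom.id K B) V'.toAlgHom r rinv p p'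
  rw [Algebra.TensorProduct.map_id] at hmap
  have hanti {x y : A ⊗[K] Bᵐᵒᵖ} (h : x * y = 1) : opE32 K A B y * opE32 K A B x = 1 := by
    rw [← opE32_mul, h, opE32_one]
  refine ⟨fun _ => rfl, ?_, ?_, ?_, ?_, map_refl_refl _, ?_, ?_⟩
  · exact mul_four_mul_inv (by rw [← map_mul, h1, map_one]) (by rw [← map_mul, hpq, map_one])
      (by rw [← map_mul, hpq', map_one]) (by rw [← map_mul, h2, map_one])
  · exact mul_four_mul_inv (by rw [← map_mul, h1, map_one]) (by rw [← map_mul, hqp', map_one])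
      (by rw [← map_mul, hqp, map_one]) (by rw [← map_mul, h2, map_one])
  · rw [hU, hmap, opify_bracket, map_refl_id, opify_bracket_inv]
    exact mul_four_mul_inv (by rw [← map_mul, hp₁, map_one]) (by rw [← map_mul, hr₁, map_one])
      (hanti hr₃) (by rw [← map_mul, hp'₁, map_one])
  · rw [hU, hmap, opify_bracket, map_refl_id, opify_bracket_inv]
    exact mul_four_mul_inv (by rw [← map_mul, hp'₂, map_one]) (hanti hr₄)
      (by rw [← map_mul, hr₂, map_one]) (by rw [← map_mul, hp₂, map_one])
  · rw [hU, map_bracket, hr₅, hp₃, hp'₃, hrinv]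
  · exact qybe_bracket h1 h2 hp hp' h3 h4 rfl

end Assembly

end OQApaper

/-- Corollary 3.9: `(H ⊗ H', [p,p'], id, S_H⁻² ⊗ S_{H'}⁻²)` is an OQA,
where `[p,p'] = r_k pᵢ ⊗ p'ⱼ R^n ⊗ pⁱ R_n ⊗ r^k p'ʲ`. -/
theorem qt_weakR_oqa (K : Type*) [Field K] (A B : Type*) [Ring A] [Ring B]
    [HopfAlgebra K A] [HopfAlgebra K B]
    (p : A ⊗[K] A) (p' : B ⊗[K] B) (hp : IsQT K p) (hp' : IsQT K p')
    (r rinv : A ⊗[K] B) (h1 : r * rinv = 1) (h2 : rinv * r = 1)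
    (hw : IsWeakR K r) :
    ∃ (V : A ≃ₐ[K] A) (V' : B ≃ₐ[K] B),
      (∀ a : A, HopfAlgebra.antipode (R := K) (HopfAlgebra.antipode (R := K) (V a)) = a) ∧
      (∀ a : A, V (HopfAlgebra.antipode (R := K) (HopfAlgebra.antipode (R := K) a)) = a) ∧
      (∀ b : B, HopfAlgebra.antipode (R := K) (HopfAlgebra.antipode (R := K) (V' b)) = b) ∧
      (∀ b : B, V' (HopfAlgebra.antipode (R := K) (HopfAlgebra.antipode (R := K) b)) = b) ∧
      ∃ ainv,
        IsOQA K
          (E14 K A B A B r * E13 K A B A B p * E24 K A B A B p' * E32 K A B A B rinv)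
          ainv AlgEquiv.refl (Algebra.TensorProduct.congr V V') := by
  have hwp := hp.isWeakR
  have hwp' := hp'.isWeakR
  obtain ⟨V, hSV, hV⟩ := hp.exists_algEquiv
  obtain ⟨V', hSV', hV'⟩ := hp'.exists_algEquiv
  obtain ⟨q, hpq, hqp⟩ := isUnit_iff_exists.mp hwp.isUnit
  obtain ⟨q', hpq', hqp'⟩ := isUnit_iff_exists.mp hwp'.isUnit
  exact ⟨V, V', hSV, hV, hSV', hV', _, isOQA_bracket h1 h2 hpq hqp hpq' hqp'
    (hwp.opify_inv_mul_opify_map hpq hV) (hwp.opify_map_mul_opify_inv hpq hV)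
    (hwp'.opify_inv_mul_opify_map hpq' hV') (hwp'.opify_map_mul_opify_inv hpq' hV')
    (hw.opify_inv_mul_opify_map h1 hV') (hw.opify_map_mul_opify_inv h1 hV')
    (hw.opify_map_inv_mul_opify h1 hV hV') (hw.opify_mul_opify_map_inv h1 hV hV')
    (hwp.map_algEquiv hV hV) (hwp'.map_algEquiv hV' hV') (hw.map_algEquiv hV hV')
    (hp.emb12_mul_emb13_mul_emb23 hp.comul_left)
    (hp'.emb12_mul_emb13_mul_emb23 hp'.comul_left)
    (hp.emb12_mul_emb13_mul_emb23 hw.comul_left)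
    (hp'.emb12_mul_emb13_mul_emb23' hw.comul_right)⟩
end
end

section
/- Let H, H' be Hopf algebras with bijective antipodes, r ∈ H ⊗ H' a weak R-matrix with inverse R, and let S̄ be the antipode of the bicrossed coproduct Hopf algebra H ⋈^r H', defined by S̄(h ⊗ h') = R (S_H(h) ⊗ S_{H'}(h')) r. Then S̄ is bijective with inverse S̄⁻¹(h ⊗ h') = R (S_H⁻¹(h) ⊗ S_{H'}⁻¹(h')) r, and S̄⁻² = S_H⁻² ⊗ S_{H'}⁻². -/
open TensorProduct

noncomputable section

open OQApaper

section WeakR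

variable {K : Type*} [Field K] {A B : Type*} [Ring A] [Ring B]

lemma mul'_map_counit_comul [Bialgebra K A] (a : A) :
    LinearMap.mul' K A (TensorProduct.map (Algebra.linearMap K A ∘ₗ Coalgebra.counit)
      LinearMap.id (Coalgebra.comul (R := K) a)) = a := by
  have hc := congrArg (TensorProduct.lid K A) (Coalgebra.rTensor_counit_comul (R := K) a)
  rw [TensorProduct.lid_tmul, one_smul] at hc
  refine Eq.trans ?_ hc
  generalize Coalgebra.comul (R := K) a = z
  induction z with
  | zero => simp
  | add z₁ z₂ h₁ h₂ => simp only [map_add, h₁, h₂]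
  | tmul u v => simp [Algebra.smul_def]

lemma map_left_mul_of_comul_left [Bialgebra K A] [Algebra K B] {s : A ⊗[K] B}
    (h : TensorProduct.assoc K A A B
        (TensorProduct.map (Coalgebra.comul (R := K)) LinearMap.id s) =
      emb13 K A A B s * emb23 K A A B s) (f : A →ₗ[K] A) :
    TensorProduct.map f LinearMap.id s * s =
      TensorProduct.map (LinearMap.mul' K A ∘ₗ TensorProduct.map f LinearMap.id ∘ₗ
        Coalgebra.comul) LinearMap.id s := by
  set F : A ⊗[K] (A ⊗[K] B) →ₗ[K] A ⊗[K] B :=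
    TensorProduct.map (LinearMap.mul' K A ∘ₗ TensorProduct.map f LinearMap.id)
      LinearMap.id ∘ₗ (TensorProduct.assoc K A A B).symm.toLinearMap with hF
  have hmul (x y : A ⊗[K] B) : F (emb13 K A A B x * emb23 K A A B y) =
      TensorProduct.map f LinearMap.id x * y := by
    induction x with
    | zero => simp
    | add x₁ x₂ h₁ h₂ => simp only [map_add, add_mul, h₁, h₂]
    | tmul a b =>
      induction y with
      | zero => simp
      | add y₁ y₂ h₁ h₂ => simp only [map_add, mul_add, h₁, h₂]
      | tmul c d => simp [hF, emb13, emb23]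
  rw [← hmul, ← h, hF, LinearMap.comp_apply, LinearEquiv.coe_coe,
    LinearEquiv.symm_apply_apply, ← LinearMap.comp_apply, ← TensorProduct.map_comp]
  rfl

lemma map_right_mul_of_comul_right [Algebra K A] [Bialgebra K B] {s : A ⊗[K] B}
    (h : TensorProduct.map LinearMap.id (Coalgebra.comul (R := K)) s =
      emb12 K A B B s * emb13 K A B B s) (f : B →ₗ[K] B) :
    TensorProduct.map LinearMap.id f s * s =
      TensorProduct.map LinearMap.id (LinearMap.mul' K B ∘ₗ
        TensorProduct.map f LinearMap.id ∘ₗ Coalgebra.comul) s := by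
  set F : A ⊗[K] (B ⊗[K] B) →ₗ[K] A ⊗[K] B :=
    TensorProduct.map LinearMap.id
      (LinearMap.mul' K B ∘ₗ TensorProduct.map f LinearMap.id) with hF
  have hmul (x y : A ⊗[K] B) : F (emb12 K A B B x * emb13 K A B B y) =
      TensorProduct.map LinearMap.id f x * y := by
    induction x with
    | zero => simp
    | add x₁ x₂ h₁ h₂ => simp only [map_add, add_mul, h₁, h₂]
    | tmul a b =>
      induction y with
      | zero => simp
      | add y₁ y₂ h₁ h₂ => simp only [map_add, mul_add, h₁, h₂]
      | tmul c d => simp [hF, emb12, emb13]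
  rw [← hmul, ← h, hF, ← LinearMap.comp_apply, ← TensorProduct.map_comp]
  rfl

lemma map_antipode_left_mul_self [HopfAlgebra K A] [Algebra K B] {s : A ⊗[K] B}
    (hs : IsUnit s)
    (h : TensorProduct.assoc K A A B
        (TensorProduct.map (Coalgebra.comul (R := K)) LinearMap.id s) =
      emb13 K A A B s * emb23 K A A B s) :
    TensorProduct.map (HopfAlgebra.antipode K) LinearMap.id s * s = 1 := by
  have hanti : LinearMap.mul' K A ∘ₗ TensorProduct.map (HopfAlgebra.antipode K) LinearMap.id ∘ₗ
      Coalgebra.comul = Algebra.linearMap K A ∘ₗ Coalgebra.counit :=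
    HopfAlgebra.mul_antipode_rTensor_comul
  have hcounit : LinearMap.mul' K A ∘ₗ TensorProduct.map
      (Algebra.linearMap K A ∘ₗ Coalgebra.counit) LinearMap.id ∘ₗ Coalgebra.comul =
      LinearMap.id := LinearMap.ext mul'_map_counit_comul
  rw [map_left_mul_of_comul_left h, hanti]
  refine hs.mul_right_cancel ?_
  rw [map_left_mul_of_comul_left h, hcounit, TensorProduct.map_id, LinearMap.id_apply, one_mul]

lemma map_antipode_right_mul_self [Algebra K A] [HopfAlgebra K B] {s : A ⊗[K] B}
    (hs : IsUnit s)
    (h : TensorProduct.map LinearMap.id (Coalgebra.comul (R := K)) s =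
      emb12 K A B B s * emb13 K A B B s) :
    TensorProduct.map LinearMap.id (HopfAlgebra.antipode K) s * s = 1 := by
  have hanti : LinearMap.mul' K B ∘ₗ TensorProduct.map (HopfAlgebra.antipode K) LinearMap.id ∘ₗ
      Coalgebra.comul = Algebra.linearMap K B ∘ₗ Coalgebra.counit :=
    HopfAlgebra.mul_antipode_rTensor_comul
  have hcounit : LinearMap.mul' K B ∘ₗ TensorProduct.map
      (Algebra.linearMap K B ∘ₗ Coalgebra.counit) LinearMap.id ∘ₗ Coalgebra.comul =
      LinearMap.id := LinearMap.ext mul'_map_counit_comul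
  rw [map_right_mul_of_comul_right h, hanti]
  refine hs.mul_right_cancel ?_
  rw [map_right_mul_of_comul_right h, hcounit, TensorProduct.map_id, LinearMap.id_apply, one_mul]

/-- The inverse of a weak R-matrix satisfies `(id ⊗ Δ)(r⁻¹) = r⁻¹₁₂ r⁻¹₁₃`. -/
lemma OQApaper.IsWeakR.comul_right_inv [Bialgebra K A] [Bialgebra K B] {r rinv : A ⊗[K] B}
    (hw : IsWeakR K r) (h1 : r * rinv = 1) (h2 : rinv * r = 1) :
    TensorProduct.map LinearMap.id (Coalgebra.comul (R := K)) rinv =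
      emb12 K A B B rinv * emb13 K A B B rinv := by
  let D := Algebra.TensorProduct.map (AlgHom.id K A) (Bialgebra.comulAlgHom K B)
  have hD : D r = emb13 K A B B r * emb12 K A B B r := hw.comul_right
  refine left_inv_eq_right_inv (b := D rinv) (a := D r) (by rw [← map_mul, h2, map_one]) ?_
  rw [hD, mul_assoc, ← mul_assoc (emb12 K A B B r), ← map_mul, h1, map_one, one_mul,
    ← map_mul, h1, map_one]

lemma OQApaper.IsWeakR.map_antipode_antipode_s13 [HopfAlgebra K A] [HopfAlgebra K B] {r : A ⊗[K] B}
    (hw : IsWeakR K r) :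
    TensorProduct.map (HopfAlgebra.antipode K) (HopfAlgebra.antipode K) r = r := by
  obtain ⟨rinv, h1, h2⟩ := isUnit_iff_exists.mp hw.isUnit
  have hl : TensorProduct.map (HopfAlgebra.antipode K) LinearMap.id r = rinv :=
    left_inv_eq_right_inv (map_antipode_left_mul_self hw.isUnit hw.comul_left) h1
  have hr : TensorProduct.map LinearMap.id (HopfAlgebra.antipode K) rinv = r :=
    left_inv_eq_right_inv (map_antipode_right_mul_self
      (isUnit_iff_exists.mpr ⟨r, h2, h1⟩) (hw.comul_right_inv h1 h2)) h2
  rw [← LinearMap.id_comp (HopfAlgebra.antipode K (A := A)),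
    ← LinearMap.comp_id (HopfAlgebra.antipode K (A := B)), TensorProduct.map_comp,
    LinearMap.comp_apply, hl, hr]

lemma map_antipode_mul_antidistrib [HopfAlgebra K A] [HopfAlgebra K B] (x y : A ⊗[K] B) :
    TensorProduct.map (HopfAlgebra.antipode K) (HopfAlgebra.antipode K) (x * y) =
      TensorProduct.map (HopfAlgebra.antipode K) (HopfAlgebra.antipode K) y *
        TensorProduct.map (HopfAlgebra.antipode K) (HopfAlgebra.antipode K) x := by
  induction x with
  | zero => simp
  | add x₁ x₂ h₁ h₂ => simp only [map_add, add_mul, mul_add, h₁, h₂]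
  | tmul a b =>
    induction y with
    | zero => simp
    | add y₁ y₂ h₁ h₂ => simp only [map_add, add_mul, mul_add, h₁, h₂]
    | tmul c d => simp [HopfAlgebra.antipode_mul_antidistrib]

end WeakR

/-- from Theorem 3.10: the antipode
`S̄(z) = r⁻¹ ((S_H ⊗ S_{H'}) z) r` of the bicrossed coproduct is bijective with inverse
`z ↦ r⁻¹ ((S_H⁻¹ ⊗ S_{H'}⁻¹) z) r`, and `S̄⁻² = S_H⁻² ⊗ S_{H'}⁻²`. -/
theorem bicrossed_antipode_sq (K : Type*) [Field K] (A B : Type*) [Ring A] [Ring B]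
    [HopfAlgebra K A] [HopfAlgebra K B]
    (Sinv : A →ₗ[K] A) (S'inv : B →ₗ[K] B)
    (hS1 : ∀ a : A, Sinv (HopfAlgebra.antipode (R := K) a) = a)
    (hS2 : ∀ a : A, HopfAlgebra.antipode (R := K) (Sinv a) = a)
    (hS'1 : ∀ b : B, S'inv (HopfAlgebra.antipode (R := K) b) = b)
    (hS'2 : ∀ b : B, HopfAlgebra.antipode (R := K) (S'inv b) = b)
    (r rinv : A ⊗[K] B) (h1 : r * rinv = 1) (h2 : rinv * r = 1)
    (hw : IsWeakR K r) :
    (∀ z : A ⊗[K] B,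
      rinv * TensorProduct.map Sinv S'inv
        (rinv * TensorProduct.map (HopfAlgebra.antipode (R := K))
          (HopfAlgebra.antipode (R := K)) z * r) * r = z) ∧
    (∀ z : A ⊗[K] B,
      rinv * TensorProduct.map (HopfAlgebra.antipode (R := K))
        (HopfAlgebra.antipode (R := K))
        (rinv * TensorProduct.map Sinv S'inv z * r) * r = z) ∧
    (∀ z : A ⊗[K] B,
      rinv * TensorProduct.map Sinv S'inv
        (rinv * TensorProduct.map Sinv S'inv z * r) * r =
      TensorProduct.map (Sinv ∘ₗ Sinv) (S'inv ∘ₗ S'inv) z) := by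
  set T := TensorProduct.map (HopfAlgebra.antipode K (A := A)) (HopfAlgebra.antipode K (A := B))
    with hT
  set U := TensorProduct.map Sinv S'inv with hU
  have hUT (z : A ⊗[K] B) : U (T z) = z := by
    rw [hU, hT, ← LinearMap.comp_apply, ← TensorProduct.map_comp,
      show Sinv ∘ₗ HopfAlgebra.antipode K = LinearMap.id from LinearMap.ext hS1,
      show S'inv ∘ₗ HopfAlgebra.antipode K = LinearMap.id from LinearMap.ext hS'1,
      TensorProduct.map_id, LinearMap.id_apply]
  have hTU (z : A ⊗[K] B) : T (U z) = z := by
    rw [hU, hT, ← LinearMap.comp_apply, ← TensorProduct.map_comp,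
      show HopfAlgebra.antipode K ∘ₗ Sinv = LinearMap.id from LinearMap.ext hS2,
      show HopfAlgebra.antipode K ∘ₗ S'inv = LinearMap.id from LinearMap.ext hS'2,
      TensorProduct.map_id, LinearMap.id_apply]
  have hTmul (x y : A ⊗[K] B) : T (x * y) = T y * T x := map_antipode_mul_antidistrib x y
  have hUmul (x y : A ⊗[K] B) : U (x * y) = U y * U x := by
    rw [← hUT (U y * U x), hTmul, hTU, hTU]
  have hTr : T r = r := hw.map_antipode_antipode_s13
  have hT1 : T 1 = 1 := by simp [hT, Algebra.TensorProduct.one_def]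
  have hTrinv : T rinv = rinv :=
    left_inv_eq_right_inv (by rw [← hT1, ← h1, hTmul, hTr]) h1
  have hUr : U r = r := by simpa only [hTr] using hUT r
  have hUrinv : U rinv = rinv := by simpa only [hTrinv] using hUT rinv
  have hconj (x : A ⊗[K] B) : rinv * (r * (x * rinv)) * r = x := by
    rw [← mul_assoc rinv, h2, one_mul, mul_assoc, h2, mul_one]
  refine ⟨fun z => ?_, fun z => ?_, fun z => ?_⟩
  · rw [hUmul, hUmul, hUr, hUrinv, hUT, hconj]
  · rw [hTmul, hTmul, hTr, hTrinv, hTU, hconj]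
  · rw [hUmul, hUmul, hUr, hUrinv, hconj, TensorProduct.map_comp, LinearMap.comp_apply]
end
end
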